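/- arXiv:2210.07854 — 3 statements merged into one kernel-verified Lean document; each statement's English description precedes it below -/
import Mathlib

section
/- Suppose f : ℚ → ℂ has property 𝒮(λ) for some λ > 1, and let f* be its extension: f*(x) := f(x) for x ∈ ℚ, and f*(x) := lim_{y→x, y ∈ ℚ∩𝔗(B)} f(y) for x ∈ 𝔗(B)\ℚ (this limit exists and is independent of the admissible B). For q ≥ 2 set B_q := (log q)·(log log q)², 𝔄_q := {a ∈ ℤ : 0 ≤ a < q, gcd(a,q) = 1, a/q ∈ 𝔗(B_q)} and 𝔗_q := ([0,1)\ℚ) ∩ 𝔗(B_q). Then, as q → ∞, sup |f*(a/q) − f*(x)| → 0, where the supremum is taken over all a ∈ 𝔄_q and all x ∈ ((a − q^{1/4})/q, (a + q^{1/4})/q) ∩ (𝔗_q ∪ {b/q : b ∈ 𝔄_q}). -/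
open Filter Topology MeasureTheory Set

/-- Partial quotients of the regular continued fraction expansion of `x`
(with the convention that `cfb j x = 0` for `j` beyond the length `r(x)` of the
expansion; for `1 ≤ j ≤ r(x)` one has `cfb j x ≥ 1`). -/
noncomputable def cfb : ℕ → ℝ → ℤ
  | 0, x => ⌊x⌋
  | n + 1, x => cfb n (Int.fract x)⁻¹

/-- `m ≤ r(x)`, where `r(x)` is the length of the continued fraction expansion of `x`
(`r(x) = ∞` for irrational `x`). -/
def cfLenGe (x : ℝ) (m : ℕ) : Prop := m = 0 ∨ 1 ≤ cfb m x

/-- The set `𝔗(B)` of reals all of whose partial quotients `b_j`, `1 ≤ j ≤ r(x)`,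
satisfy `b_j ≤ max (B, j (log j)²)`. -/
def Tset (B : ℝ) : Set ℝ :=
  {x : ℝ | ∀ j : ℕ, 1 ≤ j → 1 ≤ cfb j x →
    (cfb j x : ℝ) ≤ max B ((j : ℝ) * (Real.log j) ^ 2)}

/-- The set `V(B, m, x)` of rationals in `𝔗(B)`, of continued fraction length at least
`m`, whose first `m` partial quotients agree with those of `x`. -/
def Vset (B : ℝ) (m : ℕ) (x : ℝ) : Set ℚ :=
  {x' : ℚ | (x' : ℝ) ∈ Tset B ∧ cfLenGe (x' : ℝ) m ∧ ∀ j ≤ m, cfb j (x' : ℝ) = cfb j x}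

/-- Property `𝒮(λ)` : `Δ_λ(m) := sup_{x ∈ 𝔗(m^λ)} sup_{x', x'' ∈ V(m^λ, m, x)}
|f(x') − f(x'')| → 0` as `m → ∞`. -/
def propS (lam : ℝ) (f : ℚ → ℂ) : Prop :=
  ∀ ε : ℝ, 0 < ε → ∃ M : ℕ, ∀ m : ℕ, M ≤ m →
    ∀ x ∈ Tset ((m : ℝ) ^ lam), ∀ x' ∈ Vset ((m : ℝ) ^ lam) m x,
      ∀ x'' ∈ Vset ((m : ℝ) ^ lam) m x, ‖f x' - f x''‖ ≤ ε

theorem cfb_zero_right (n : ℕ) : cfb n 0 = 0 := by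
  induction n with
  | zero => simp [cfb]
  | succ n ih => simpa [cfb] using ih

theorem one_lt_inv_fract {x : ℝ} (h : Int.fract x ≠ 0) : 1 < (Int.fract x)⁻¹ :=
  (one_lt_inv₀ (lt_of_le_of_ne (Int.fract_nonneg x) h.symm)).2 (Int.fract_lt_one x)

theorem fract_ne_zero_of_one_le_cfb {x : ℝ} {n : ℕ} (h : 1 ≤ cfb (n + 1) x) :
    Int.fract x ≠ 0 := by
  intro h0
  simp [cfb, h0, cfb_zero_right] at h

/-- A real with an early vanishing partial quotient is a rational of small denominator. -/
theorem exists_denominator_of_cfb_lt_one {K : ℝ} (hK : 0 ≤ K) (n : ℕ) (x : ℝ)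
    (hn : 1 ≤ n) (hb : ∀ j, 1 ≤ j → j ≤ n → (cfb j x : ℝ) ≤ K) (h : cfb n x < 1) :
    ∃ d : ℕ, 0 < d ∧ (d : ℝ) ≤ (K + 1) ^ n ∧ ∃ p : ℤ, x * d = p := by
  induction n generalizing x with
  | zero => omega
  | succ n ih =>
    by_cases h0 : Int.fract x = 0
    · refine ⟨1, one_pos, by simpa using one_le_pow₀ (by linarith), ⌊x⌋, ?_⟩
      have := Int.floor_add_fract x
      simp; linarith
    · have hw := one_lt_inv_fract h0
      have hw' : (Int.fract x)⁻¹ < K + 1 := by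
        have h1 := hb 1 le_rfl (by omega)
        simp only [cfb] at h1
        linarith [Int.lt_floor_add_one (Int.fract x)⁻¹]
      rcases Nat.eq_zero_or_pos n with rfl | hn'
      · have : 1 ≤ ⌊(Int.fract x)⁻¹⌋ := Int.le_floor.2 (by simpa using hw.le)
        simp only [cfb] at h
        omega
      · obtain ⟨d, hd, hdK, p, hp⟩ := ih (Int.fract x)⁻¹ hn'
          (fun j hj hjn => hb (j + 1) (by omega) (by omega)) h
        have hd' : (0 : ℝ) < d := by exact_mod_cast hd
        have hp0 : (0 : ℝ) < p := by rw [← hp]; positivity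
        have hp0' : 0 < p := by exact_mod_cast hp0
        have hcast : ((p.toNat : ℕ) : ℝ) = p := by
          exact_mod_cast congrArg (Int.cast (R := ℝ)) (Int.toNat_of_nonneg hp0'.le)
        refine ⟨p.toNat, by omega, ?_, ⌊x⌋ * p + d, ?_⟩
        · rw [hcast, ← hp, pow_succ, mul_comm]
          exact mul_le_mul hdK hw'.le (by linarith) (by positivity)
        · rw [hcast]
          have h1 : Int.fract x * p = d := by rw [← hp]; field_simp
          push_cast
          rw [← h1]
          linear_combination (-(p : ℝ)) * Int.floor_add_fract x

theorem irrational_inv_fract {x : ℝ} (hx : Irrational x) : Irrational (Int.fract x)⁻¹ := by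
  rw [irrational_inv_iff, Int.fract]
  exact hx.sub_intCast _

theorem fract_ne_zero_of_irrational {x : ℝ} (hx : Irrational x) : Int.fract x ≠ 0 := by
  have := (irrational_inv_fract hx).ne_zero
  simpa using this

theorem one_le_cfb_of_irrational {x : ℝ} (hx : Irrational x) (n : ℕ) : 1 ≤ cfb (n + 1) x := by
  induction n generalizing x with
  | zero =>
    simp only [cfb]
    exact Int.le_floor.2 (by
      simpa using (one_lt_inv_fract (fract_ne_zero_of_irrational hx)).le)
  | succ n ih => exact ih (irrational_inv_fract hx)

theorem floor_le_of_abs_sub_lt {K x y : ℝ}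
    (hy : 1 ≤ cfb 1 y) (hyK : (cfb 1 y : ℝ) ≤ K) (h : |x - y| < (K + 1)⁻¹) : ⌊y⌋ ≤ ⌊x⌋ := by
  have h0 := fract_ne_zero_of_one_le_cfb hy
  have hw := one_lt_inv_fract h0
  have hw' : (Int.fract y)⁻¹ < K + 1 := by
    simp only [cfb] at hyK
    linarith [Int.lt_floor_add_one (Int.fract y)⁻¹]
  have h1 : (K + 1)⁻¹ < Int.fract y := by
    rw [inv_lt_comm₀ (by linarith) (by
      exact lt_of_le_of_ne (Int.fract_nonneg y) h0.symm)]
    exact hw'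
  have := (abs_lt.1 h).1
  exact Int.le_floor.2 (by linarith [Int.floor_add_fract y])

theorem inv_fract_sub_inv_fract {x y : ℝ} (hx : Int.fract x ≠ 0) (hy : Int.fract y ≠ 0)
    (h : ⌊x⌋ = ⌊y⌋) :
    (Int.fract x)⁻¹ - (Int.fract y)⁻¹ = (y - x) * ((Int.fract x)⁻¹ * (Int.fract y)⁻¹) := by
  have h1 : y - x = Int.fract y - Int.fract x := by
    rw [Int.fract, Int.fract, h]; ring
  rw [h1]
  field_simp

/-- Close reals with bounded partial quotients share their first partial quotients. -/
theorem cfb_eq_of_abs_sub_lt {K : ℝ} (hK : 0 ≤ K) (n : ℕ) (x y : ℝ)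
    (hx : ∀ j, 1 ≤ j → j ≤ n + 1 → 1 ≤ cfb j x ∧ (cfb j x : ℝ) ≤ K)
    (hy : ∀ j, 1 ≤ j → j ≤ n + 1 → 1 ≤ cfb j y ∧ (cfb j y : ℝ) ≤ K)
    (h : |x - y| < ((K + 1) ^ (2 * n + 1))⁻¹) : ∀ j ≤ n, cfb j x = cfb j y := by
  induction n generalizing x y with
  | zero =>
    intro j hj
    obtain rfl : j = 0 := by omega
    simp only [mul_zero, zero_add, pow_one] at h
    exact le_antisymm
      (floor_le_of_abs_sub_lt (hx 1 le_rfl le_rfl).1 (hx 1 le_rfl le_rfl).2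
        (by rwa [abs_sub_comm]))
      (floor_le_of_abs_sub_lt (hy 1 le_rfl le_rfl).1 (hy 1 le_rfl le_rfl).2 h)
  | succ n ih =>
    have hx1 := hx 1 le_rfl (by omega)
    have hy1 := hy 1 le_rfl (by omega)
    have h' : |x - y| < (K + 1)⁻¹ := by
      refine h.trans_le (inv_anti₀ (by linarith) ?_)
      exact le_self_pow₀ (by linarith) (by omega)
    have hfl : ⌊x⌋ = ⌊y⌋ := le_antisymm
      (floor_le_of_abs_sub_lt hx1.1 hx1.2 (by rwa [abs_sub_comm]))
      (floor_le_of_abs_sub_lt hy1.1 hy1.2 h')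
    intro j hj
    cases j with
    | zero => exact hfl
    | succ j =>
      have hfx := fract_ne_zero_of_one_le_cfb hx1.1
      have hfy := fract_ne_zero_of_one_le_cfb hy1.1
      refine ih (Int.fract x)⁻¹ (Int.fract y)⁻¹
        (fun i hi hin => hx (i + 1) (by omega) (by omega))
        (fun i hi hin => hy (i + 1) (by omega) (by omega)) ?_ j (by omega)
      have hX := one_lt_inv_fract hfx
      have hY := one_lt_inv_fract hfy
      have hXK : (Int.fract x)⁻¹ < K + 1 := by
        have := hx1.2
        simp only [cfb] at this
        linarith [Int.lt_floor_add_one (Int.fract x)⁻¹]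
      have hYK : (Int.fract y)⁻¹ < K + 1 := by
        have := hy1.2
        simp only [cfb] at this
        linarith [Int.lt_floor_add_one (Int.fract y)⁻¹]
      rw [inv_fract_sub_inv_fract hfx hfy hfl, abs_mul, abs_sub_comm y x,
        abs_of_pos (a := (Int.fract x)⁻¹ * (Int.fract y)⁻¹) (by positivity)]
      have hP : (Int.fract x)⁻¹ * (Int.fract y)⁻¹ ≤ (K + 1) * (K + 1) :=
        mul_le_mul hXK.le hYK.le (by positivity) (by positivity)
      calc |x - y| * ((Int.fract x)⁻¹ * (Int.fract y)⁻¹)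
          < ((K + 1) ^ (2 * (n + 1) + 1))⁻¹ * ((Int.fract x)⁻¹ * (Int.fract y)⁻¹) :=
            mul_lt_mul_of_pos_right h (by positivity)
        _ ≤ ((K + 1) ^ (2 * (n + 1) + 1))⁻¹ * ((K + 1) * (K + 1)) := by gcongr
        _ = ((K + 1) ^ (2 * n + 1))⁻¹ := by
            have : K + 1 ≠ 0 := by positivity
            field_simp
            ring

/-- Reals sharing many partial quotients are close. -/
theorem abs_sub_le_of_cfb_eq (k : ℕ) (x y : ℝ) (hx : ∀ j, 1 ≤ j → j ≤ 2 * k → 1 ≤ cfb j x)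
    (h : ∀ j ≤ 2 * k, cfb j x = cfb j y) : |x - y| ≤ (1 / 4 : ℝ) ^ k := by
  induction k generalizing x y with
  | zero =>
    have h0 := h 0 le_rfl
    simp only [cfb] at h0
    simpa using (Int.abs_sub_lt_one_of_floor_eq_floor h0).le
  | succ k ih =>
    have hy : ∀ j, 1 ≤ j → j ≤ 2 * (k + 1) → 1 ≤ cfb j y := fun j h1 h2 => h j h2 ▸ hx j h1 h2
    have key : ∀ z : ℝ, 1 ≤ cfb 1 z → 1 ≤ cfb 2 z → Int.fract z ≠ 0 ∧
        Int.fract (Int.fract z)⁻¹ ≠ 0 ∧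
        2 ≤ (Int.fract z)⁻¹ * (Int.fract (Int.fract z)⁻¹)⁻¹ := by
      intro z h1 h2
      have a := fract_ne_zero_of_one_le_cfb h1
      have b : Int.fract (Int.fract z)⁻¹ ≠ 0 :=
        fract_ne_zero_of_one_le_cfb (n := 0) (x := (Int.fract z)⁻¹) h2
      refine ⟨a, b, ?_⟩
      have h3 : (1 : ℝ) ≤ ⌊(Int.fract z)⁻¹⌋ := by exact_mod_cast h1
      have h4 := one_lt_inv_fract b
      have h5 := Int.floor_add_fract (Int.fract z)⁻¹
      have h6 : Int.fract (Int.fract z)⁻¹ * (Int.fract (Int.fract z)⁻¹)⁻¹ = 1 :=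
        mul_inv_cancel₀ b
      nlinarith
    obtain ⟨ax, bx, cx⟩ := key x (hx 1 le_rfl (by omega)) (hx 2 (by omega) (by omega))
    obtain ⟨ay, hby, cy⟩ := key y (hy 1 le_rfl (by omega)) (hy 2 (by omega) (by omega))
    have e0 := inv_fract_sub_inv_fract ax ay (h 0 (by omega))
    have e1 := inv_fract_sub_inv_fract bx hby (h 1 (by omega))
    have hI := ih (Int.fract (Int.fract x)⁻¹)⁻¹ (Int.fract (Int.fract y)⁻¹)⁻¹
      (fun i hi hin => hx (i + 2) (by omega) (by omega))
      (fun i hi => h (i + 2) (by omega))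
    set X := (Int.fract x)⁻¹
    set Y := (Int.fract y)⁻¹
    set X' := (Int.fract X)⁻¹
    set Y' := (Int.fract Y)⁻¹
    have e2 : X' - Y' = (x - y) * ((X * X') * (Y * Y')) := by
      rw [e1, show Y - X = (x - y) * (X * Y) by linear_combination -e0]
      ring
    have hP : 4 ≤ (X * X') * (Y * Y') := by nlinarith
    rw [e2, abs_mul, abs_of_pos (a := (X * X') * (Y * Y')) (by linarith)] at hI
    rw [pow_succ]
    nlinarith [abs_nonneg (x - y)]

theorem cfb_intCast_add_inv {y : ℝ} (hy : 1 < y) (b : ℤ) :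
    cfb 0 (b + y⁻¹) = b ∧ ∀ n, cfb (n + 1) (b + y⁻¹) = cfb n y := by
  have h0 : 0 < y⁻¹ := by positivity
  have h1 : y⁻¹ < 1 := inv_lt_one_of_one_lt₀ hy
  have hfl : ⌊(b : ℝ) + y⁻¹⌋ = b := by
    rw [Int.floor_eq_iff]; constructor <;> linarith
  refine ⟨hfl, fun n => ?_⟩
  have : Int.fract ((b : ℝ) + y⁻¹) = y⁻¹ := by rw [Int.fract, hfl]; ring
  simp [cfb, -Int.fract_intCast_add, this]

/-- The rational `[b₀; b₁, …, bₙ, 2]` attached to an irrational `[b₀; b₁, …]`. -/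
theorem exists_rat_cfb_eq (n : ℕ) (x : ℝ) (hx : Irrational x) :
    ∃ y : ℚ, (∀ j ≤ n, cfb j (y : ℝ) = cfb j x) ∧ cfb (n + 1) (y : ℝ) = 2 ∧
      ∀ j, n + 1 < j → cfb j (y : ℝ) = 0 := by
  induction n generalizing x with
  | zero =>
    obtain ⟨h0, h1⟩ := cfb_intCast_add_inv (y := 2) (by norm_num) ⌊x⌋
    refine ⟨⌊x⌋ + 2⁻¹, ?_, ?_, ?_⟩
    · intro j hj
      obtain rfl : j = 0 := by omega
      push_cast
      exact h0
    · push_cast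
      rw [h1]
      simp [cfb]
    · intro j hj
      obtain ⟨i, rfl⟩ : ∃ i, j = i + 1 + 1 := ⟨j - 2, by omega⟩
      push_cast
      rw [h1]
      simp [cfb, cfb_zero_right]
  | succ n ih =>
    obtain ⟨y, hy, hy2, hy0⟩ := ih _ (irrational_inv_fract hx)
    have hge : (1 : ℝ) ≤ y := by
      have := one_le_cfb_of_irrational hx 0
      have h0 : cfb 0 (y : ℝ) = cfb 1 x := hy 0 (by omega)
      rw [← h0] at this
      simpa using Int.le_floor.1 this
    have hne : (y : ℝ) ≠ 1 := by
      intro h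
      rw [h] at hy2
      simp [cfb, cfb_zero_right] at hy2
    obtain ⟨h0, h1⟩ := cfb_intCast_add_inv (lt_of_le_of_ne hge hne.symm) ⌊x⌋
    refine ⟨⌊x⌋ + y⁻¹, ?_, ?_, ?_⟩
    · intro j hj
      push_cast
      cases j with
      | zero => exact h0
      | succ j => rw [h1]; exact hy j (by omega)
    · push_cast
      rw [h1]; exact hy2
    · intro j hj
      push_cast
      obtain ⟨i, rfl⟩ : ∃ i, j = i + 1 := ⟨j - 1, by omega⟩
      rw [h1]; exact hy0 i (by omega)

theorem Tset_mono {B C : ℝ} (h : B ≤ C) : Tset B ⊆ Tset C :=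
  fun _ hx j hj hj' => (hx j hj hj').trans (max_le_max_right _ h)

/-- An irrational of `𝔗(B)` is approximated by rationals of `V(B, m, x)`. -/
theorem exists_mem_Vset_abs_sub_lt {B : ℝ} (hB : 2 ≤ B) {x : ℝ} (hx : Irrational x)
    (hxB : x ∈ Tset B) (m : ℕ) {δ : ℝ} (hδ : 0 < δ) : ∃ y ∈ Vset B m x, |(y : ℝ) - x| < δ := by
  obtain ⟨k, hk⟩ := exists_pow_lt_of_lt_one hδ (by norm_num : (1 / 4 : ℝ) < 1)
  obtain ⟨y, hy, hy2, hy0⟩ := exists_rat_cfb_eq (2 * (m + k)) x hx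
  have hpos : ∀ j, 1 ≤ j → 1 ≤ cfb j x := by
    intro j hj
    obtain ⟨i, rfl⟩ : ∃ i, j = i + 1 := ⟨j - 1, by omega⟩
    exact one_le_cfb_of_irrational hx i
  refine ⟨y, ⟨?_, ?_, fun j hj => hy j (by omega)⟩, ?_⟩
  · intro j hj hj'
    rcases lt_trichotomy j (2 * (m + k) + 1) with h | h | h
    · rw [hy j (by omega)]
      exact hxB j hj (hpos j hj)
    · rw [h, hy2]
      exact le_max_of_le_left (by exact_mod_cast hB)
    · rw [hy0 j h] at hj'
      omega
  · rcases Nat.eq_zero_or_pos m with h | h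
    · exact Or.inl h
    · exact Or.inr (by rw [hy m (by omega)]; exact hpos m h)
  · rw [abs_sub_comm]
    refine (abs_sub_le_of_cfb_eq (m + k) x y (fun j hj _ => hpos j hj)
      (fun j hj => (hy j hj).symm)).trans_lt (lt_of_le_of_lt ?_ hk)
    exact pow_le_pow_of_le_one (by norm_num) (by norm_num) (by omega)

theorem dvd_of_div_mul_eq_intCast {b q d : ℕ} (hq : 0 < q) (hbq : Nat.Coprime b q) {p : ℤ}
    (h : (b : ℝ) / q * d = p) : q ∣ d := by
  have hq' : (q : ℝ) ≠ 0 := by positivity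
  have h1 : (b : ℝ) * d = p * q := by rw [← h]; field_simp
  have h2 : (b : ℤ) * d = p * q := by exact_mod_cast h1
  have h3 : (q : ℤ) ∣ (b * d : ℕ) := ⟨p, by push_cast; rw [h2]; ring⟩
  exact hbq.symm.dvd_of_dvd_mul_left (Int.natCast_dvd_natCast.1 h3)

/-- The partial quotients of an element of `𝔗(K)` which is not a rational of small denominator. -/
theorem cfb_bounds_of_mem_Tset {K : ℝ} {N : ℕ} (hK : 1 ≤ K)
    (hNK : (N : ℝ) * Real.log N ^ 2 ≤ K) {x : ℝ} (hx : x ∈ Tset K)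
    (hden : ∀ d : ℕ, 0 < d → (d : ℝ) ≤ (K + 1) ^ N → ∀ p : ℤ, x * d ≠ p) :
    ∀ j, 1 ≤ j → j ≤ N → 1 ≤ cfb j x ∧ (cfb j x : ℝ) ≤ K := by
  have hle : ∀ j, 1 ≤ j → j ≤ N → (cfb j x : ℝ) ≤ K := by
    intro j hj hjN
    rcases lt_or_ge (cfb j x) 1 with h | h
    · have : (cfb j x : ℝ) < 1 := by exact_mod_cast h
      linarith
    · refine (hx j hj h).trans (max_le le_rfl (le_trans ?_ hNK))
      have h1 : (1 : ℝ) ≤ j := by exact_mod_cast hj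
      have h2 : (j : ℝ) ≤ N := by exact_mod_cast hjN
      have h3 : Real.log j ≤ Real.log N := Real.log_le_log (by linarith) h2
      have h4 := Real.log_nonneg h1
      gcongr
  refine fun j hj hjN => ⟨?_, hle j hj hjN⟩
  by_contra! h
  obtain ⟨d, hd, hdK, p, hp⟩ := exists_denominator_of_cfb_lt_one (by linarith : (0 : ℝ) ≤ K) j x hj
    (fun i hi hij => hle i hi (hij.trans hjN)) h
  exact hden d hd (hdK.trans (pow_le_pow_right₀ (by linarith) hjN)) p hp

theorem eventually_log_le_mul_rpow {c s : ℝ} (hc : 0 < c) (hs : 0 < s) :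
    ∀ᶠ L : ℝ in atTop, Real.log L ≤ c * L ^ s := by
  filter_upwards [(isLittleO_log_rpow_atTop hs).bound hc, eventually_ge_atTop 1] with L h h1
  rw [Real.norm_eq_abs, Real.norm_eq_abs, abs_of_nonneg (Real.log_nonneg h1),
    abs_of_nonneg (by positivity)] at h
  exact h

/-- The number `m` of partial quotients, as a function of `L = log q`. -/
theorem eventually_exists_prefix_length {lam : ℝ} (hlam : 1 < lam) (M : ℕ) :
    ∀ᶠ L : ℝ in atTop, ∃ m : ℕ, M ≤ m ∧ (m : ℝ) + 1 ≤ L ∧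
      L * Real.log L ^ 2 ≤ (m : ℝ) ^ lam ∧ 2 ≤ L * Real.log L ^ 2 ∧
      (L * Real.log L ^ 2 + 1) ^ (2 * m + 1) * Real.exp (L / 4) ≤ Real.exp L := by
  obtain ⟨γ, hγlam, hγ_lt⟩ : ∃ γ : ℝ, 1 < γ * lam ∧ γ < 1 := by
    obtain ⟨γ, h1, h2⟩ := exists_between (inv_lt_one_of_one_lt₀ hlam)
    exact ⟨γ, (inv_lt_iff_one_lt_mul₀ (by linarith)).1 h1, h2⟩
  have hγ0 : 0 < γ := by
    by_contra! h
    nlinarith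
  set s := (γ * lam - 1) / 2 with hs
  have hs0 : 0 < s := by linarith
  have hc : (0 : ℝ) < (1 / 2) ^ (lam / 2) := by positivity
  filter_upwards [eventually_log_le_mul_rpow (c := 1 / 8) (by norm_num) (sub_pos.2 hγ_lt),
    eventually_log_le_mul_rpow (c := 1 / 2) (s := 1 / 2) (by norm_num) (by norm_num),
    eventually_log_le_mul_rpow hc hs0,
    (tendsto_rpow_atTop hγ0).eventually_ge_atTop ((M : ℝ) + 2),
    Real.tendsto_log_atTop.eventually_ge_atTop 1, eventually_ge_atTop 8]
    with L e1 e2 e3 e4 e5 e6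
  have hL : 0 < L := by linarith
  have hM : (0 : ℝ) ≤ M := Nat.cast_nonneg M
  have hfl := Nat.lt_floor_add_one (L ^ γ)
  have hfl' := Nat.floor_le (by positivity : 0 ≤ L ^ γ)
  have hmul : L ^ γ * L ^ (1 - γ) = L := by
    rw [← Real.rpow_add hL]; simp
  have hA : 0 < L ^ γ := by positivity
  set m := ⌊L ^ γ⌋₊
  refine ⟨m, Nat.le_floor (by linarith), ?_, ?_, ?_, ?_⟩
  · nlinarith
  · have h1 : L ^ γ * (1 / 2) ≤ m := by linarith
    have h2 : Real.log L ^ 2 ≤ ((1 / 2) ^ (lam / 2) * L ^ s) ^ 2 := by gcongr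
    calc L * Real.log L ^ 2 ≤ L * ((1 / 2) ^ (lam / 2) * L ^ s) ^ 2 := by gcongr
      _ = (L ^ γ * (1 / 2)) ^ lam := by
          rw [Real.mul_rpow hA.le (by norm_num), ← Real.rpow_mul hL.le, mul_pow,
            ← Real.rpow_natCast, ← Real.rpow_natCast, ← Real.rpow_mul (by norm_num),
            ← Real.rpow_mul hL.le]
          have : γ * lam = 1 + s * (2 : ℕ) := by rw [hs]; push_cast; ring
          rw [this, Real.rpow_add hL, Real.rpow_one]
          norm_num
          ring
      _ ≤ (m : ℝ) ^ lam := by gcongr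
  · nlinarith
  · have hsq : (L ^ (1 / 2 : ℝ)) ^ 2 = L := by
      rw [← Real.rpow_natCast, ← Real.rpow_mul hL.le]; norm_num
    have h2 : Real.log L ^ 2 ≤ L / 4 := by
      calc Real.log L ^ 2 ≤ (1 / 2 * L ^ (1 / 2 : ℝ)) ^ 2 := by gcongr
        _ = L / 4 := by rw [mul_pow, hsq]; ring
    have h3 : L * Real.log L ^ 2 + 1 ≤ Real.exp (2 * Real.log L) := by
      rw [two_mul, Real.exp_add, Real.exp_log hL]
      nlinarith
    calc (L * Real.log L ^ 2 + 1) ^ (2 * m + 1) * Real.exp (L / 4)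
        ≤ Real.exp (2 * Real.log L) ^ (2 * m + 1) * Real.exp (L / 4) := by gcongr
      _ = Real.exp ((2 * m + 1 : ℕ) * (2 * Real.log L) + L / 4) := by
          rw [← Real.exp_nat_mul, ← Real.exp_add]
      _ ≤ Real.exp L := by
          rw [Real.exp_le_exp]
          push_cast
          have h4 : (2 * m + 1 : ℝ) ≤ 3 * L ^ γ := by linarith
          have h5 : (2 * m + 1 : ℝ) * (2 * Real.log L)
              ≤ (3 * L ^ γ) * (2 * (1 / 8 * L ^ (1 - γ))) := by gcongr
          have h6 : (3 * L ^ γ) * (2 * (1 / 8 * L ^ (1 - γ))) = 3 / 4 * L := by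
            linear_combination (3 / 4 : ℝ) * hmul
          linarith

/-- Stability of `f*` near the rationals of `𝔄_q`: as `q → ∞`,
`sup |f*(a/q) − f*(x)| → 0` over `a ∈ 𝔄_q` and `x` within `q^{1/4}/q` of `a/q` lying in
`𝔗_q ∪ (1/q)𝔄_q`. -/
theorem stmt15 (lam : ℝ) (hlam : 1 < lam) (f : ℚ → ℂ) (hS : propS lam f)
    (fstar : ℝ → ℂ)
    (hrat : ∀ y : ℚ, fstar (y : ℝ) = f y)
    (hirr : ∀ B : ℝ, 0 < B → ∀ x ∈ Tset B, Irrational x →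
      Tendsto (fun y : ℚ => f y)
        (Filter.comap ((↑) : ℚ → ℝ) (nhds x) ⊓
          Filter.principal {y : ℚ | (y : ℝ) ∈ Tset B})
        (nhds (fstar x))) :
    ∀ ε : ℝ, 0 < ε → ∃ Q : ℕ, ∀ q : ℕ, Q ≤ q →
      ∀ a : ℕ, a < q → Nat.Coprime a q →
        ((a : ℝ) / q) ∈ Tset (Real.log q * (Real.log (Real.log q)) ^ 2) →
        ∀ x : ℝ,
          x ∈ Set.Ioo (((a : ℝ) - (q : ℝ) ^ ((1 : ℝ) / 4)) / q)
                       (((a : ℝ) + (q : ℝ) ^ ((1 : ℝ) / 4)) / q) →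
          ((x ∈ Set.Ico (0 : ℝ) 1 ∧ Irrational x ∧
              x ∈ Tset (Real.log q * (Real.log (Real.log q)) ^ 2)) ∨
            (∃ b : ℕ, b < q ∧ Nat.Coprime b q ∧
              ((b : ℝ) / q) ∈ Tset (Real.log q * (Real.log (Real.log q)) ^ 2) ∧
              x = (b : ℝ) / q)) →
          ‖fstar ((a : ℝ) / q) - fstar x‖ ≤ ε := by
  intro ε hε
  obtain ⟨M, hM⟩ := hS (ε / 2) (half_pos hε)
  have hev := (Real.tendsto_log_atTop.comp tendsto_natCast_atTop_atTop).eventually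
    (eventually_exists_prefix_length hlam (M + 1))
  obtain ⟨Q, hQ⟩ := eventually_atTop.1 (hev.and (eventually_ge_atTop 2))
  refine ⟨Q, fun q hq a _ haq haT x hx hxT => ?_⟩
  obtain ⟨⟨m, hMm, hmL, hBm, hB2, hexp⟩, hq2⟩ := hQ q hq
  simp only [Function.comp_apply] at hmL hBm hB2 hexp
  have hq0 : (0 : ℝ) < q := by positivity
  have hq1 : (1 : ℝ) < q := by exact_mod_cast hq2
  set K := Real.log q * Real.log (Real.log q) ^ 2 with hK
  have hm0 : (0 : ℝ) ≤ m := Nat.cast_nonneg m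
  have hquarter : Real.exp (Real.log q / 4) = (q : ℝ) ^ ((1 : ℝ) / 4) := by
    rw [Real.rpow_def_of_pos hq0]; ring_nf
  rw [hquarter, Real.exp_log hq0] at hexp
  have hqq : (1 : ℝ) < (q : ℝ) ^ ((1 : ℝ) / 4) := Real.one_lt_rpow hq1 (by norm_num)
  have hsmall : (K + 1) ^ (m + 1) < (q : ℝ) := by
    refine lt_of_lt_of_le ?_ hexp
    have h1 : (K + 1) ^ (m + 1) ≤ (K + 1) ^ (2 * m + 1) :=
      pow_le_pow_right₀ (by linarith) (by omega)
    have h2 : 0 < (K + 1) ^ (2 * m + 1) := by positivity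
    nlinarith
  have hNK : ((m + 1 : ℕ) : ℝ) * Real.log (m + 1 : ℕ) ^ 2 ≤ K := by
    push_cast
    have h1 : Real.log (m + 1) ≤ Real.log (Real.log q) := Real.log_le_log (by linarith) hmL
    have h2 : 0 ≤ Real.log ((m : ℝ) + 1) := Real.log_nonneg (by linarith)
    rw [hK]
    gcongr
  have hbq : ∀ b : ℕ, Nat.Coprime b q → (b : ℝ) / q ∈ Tset K →
      ∀ j, 1 ≤ j → j ≤ m + 1 → 1 ≤ cfb j ((b : ℝ) / q) ∧ (cfb j ((b : ℝ) / q) : ℝ) ≤ K := by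
    intro b hb hbT
    refine cfb_bounds_of_mem_Tset (by linarith) hNK hbT fun d hd hdK p hp => ?_
    have h1 : q ≤ d := Nat.le_of_dvd hd (dvd_of_div_mul_eq_intCast (by omega) hb hp)
    have h2 : (q : ℝ) ≤ d := by exact_mod_cast h1
    linarith
  have hxb : x ∈ Tset K ∧ ∀ j, 1 ≤ j → j ≤ m + 1 → 1 ≤ cfb j x ∧ (cfb j x : ℝ) ≤ K := by
    rcases hxT with ⟨_, hirrat, hxT⟩ | ⟨b, _, hb, hbT, rfl⟩
    · refine ⟨hxT, cfb_bounds_of_mem_Tset (by linarith) hNK hxT fun d hd _ p hp => ?_⟩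
      exact (hirrat.mul_natCast hd.ne').ne_int p hp
    · exact ⟨hbT, hbq b hb hbT⟩
  have hdist : |x - (a : ℝ) / q| < ((K + 1) ^ (2 * m + 1))⁻¹ := by
    have h1 : |x - (a : ℝ) / q| < (q : ℝ) ^ ((1 : ℝ) / 4) / q := by
      rw [sub_div, add_div] at hx
      rw [abs_lt]
      constructor <;> linarith [hx.1, hx.2]
    refine h1.trans_le ?_
    have h2 : 0 < (K + 1) ^ (2 * m + 1) := by positivity
    rw [div_le_iff₀ hq0, ← div_eq_inv_mul, le_div_iff₀ h2, mul_comm]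
    exact hexp
  have heq := cfb_eq_of_abs_sub_lt (by linarith) m x ((a : ℝ) / q) hxb.2 (hbq a haq haT) hdist
  have hcast : ∀ b : ℕ, (((b : ℚ) / q : ℚ) : ℝ) = (b : ℝ) / q := fun b => by push_cast; rfl
  have hmem : ∀ y ∈ Vset K m x, y ∈ Vset ((m : ℝ) ^ lam) m x :=
    fun y hy => ⟨Tset_mono hBm hy.1, hy.2⟩
  have haV : ((a : ℚ) / q) ∈ Vset K m x := by
    refine ⟨by rwa [hcast], Or.inr ?_, ?_⟩
    · rw [hcast]; exact (hbq a haq haT m (by omega) (by omega)).1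
    · rw [hcast]; exact fun j hj => (heq j hj).symm
  have hstable := fun y (hy : y ∈ Vset K m x) => hM m (by omega) x (Tset_mono hBm hxb.1) _
    (hmem _ haV) y (hmem y hy)
  rw [← hcast, hrat]
  rcases hxT with ⟨_, hirrat, hxT⟩ | ⟨b, _, hb, hbT, rfl⟩
  · have hlim := (hirr K (by linarith) x hxT hirrat).eventually
      (Metric.ball_mem_nhds _ (half_pos hε))
    rw [eventually_inf_principal, eventually_comap] at hlim
    obtain ⟨δ, hδ, hball⟩ := Metric.eventually_nhds_iff.1 hlim
    obtain ⟨y, hy, hyx⟩ := exists_mem_Vset_abs_sub_lt hB2 hirrat hxT m hδ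
    have h1 := hball (y := (y : ℝ)) (by rwa [Real.dist_eq]) y rfl hy.1
    rw [dist_eq_norm] at h1
    have h2 := norm_sub_le_norm_sub_add_norm_sub (f ((a : ℚ) / q)) (f y) (fstar x)
    linarith [hstable y hy]
  · have hbV : ((b : ℚ) / q) ∈ Vset K m ((b : ℝ) / q) := by
      refine ⟨by rwa [hcast], Or.inr ?_, ?_⟩
      · rw [hcast]; exact (hbq b hb hbT m (by omega) (by omega)).1
      · rw [hcast]; exact fun _ _ => rfl
    have h1 := hstable _ hbV
    rw [← hcast b, hrat]
    linarith
end

section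
/- Let R > 1, C ≥ 1 and δ ∈ (0,1). Let h : [−1,1]\{0} → ℝ be such that |h(x)| ≤ K·exp(|x|^{−1+δ}) for some K > 0 and all x ∈ [−1,1]\{0}, and assume that for one fixed choice of sign ±, |h(y)| → ∞ as y → 0^±. Let ξ : (0,1] → (0,1] satisfy ξ(z) → 0 as z → 0⁺. Then there exist ν > 0 and a function ψ : [1,∞) → (0,∞) with ψ(t) → ∞ as t → ∞, such that for all integers j ≥ 1 and all z ∈ (0,ν]: sup{ |h(x)|/R^j : x ∈ [−1,1], (C·j^{1+δ}·ψ(1/z))^{−1} < |x| < 1 } < (1/ψ(1/z))·inf{ |h(y)| : 0 < ±y ≤ ξ(z) }. -/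
open Filter Topology MeasureTheory Set

/-- A diagonal choice: if `f → ∞`, then any prescribed sequence `G` can be traversed slowly enough
that it stays below `f`. -/
theorem exists_slow_tendsto_atTop (f : ℝ → ℝ) (hf : Tendsto f atTop atTop) (G : ℕ → ℝ) :
    ∃ φ : ℝ → ℕ, (∀ t, 1 ≤ φ t) ∧ Tendsto φ atTop atTop ∧ ∀ᶠ t in atTop, G (φ t) < f t := by
  classical
  have hT : ∀ n, ∃ T : ℝ, ∀ t ≥ T, G n < f t := fun n =>
    eventually_atTop.1 (hf.eventually_gt_atTop (G n))
  choose T hT using hT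
  refine ⟨fun t => max 1 (Nat.findGreatest (fun n => T n ≤ t) ⌊t⌋₊), fun t => le_max_left _ _,
    ?_, ?_⟩
  · refine tendsto_atTop.2 fun N => ?_
    filter_upwards [eventually_ge_atTop (N : ℝ), eventually_ge_atTop (T N)] with t h1 h2
    exact le_max_of_le_right (Nat.le_findGreatest (Nat.le_floor h1) h2)
  · filter_upwards [eventually_ge_atTop (1 : ℝ), eventually_ge_atTop (T 1)] with t h1 h2
    have hfl : 1 ≤ ⌊t⌋₊ := Nat.le_floor (by simpa using h1)
    have hge : 1 ≤ Nat.findGreatest (fun n => T n ≤ t) ⌊t⌋₊ := Nat.le_findGreatest hfl h2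
    rw [max_eq_right hge]
    exact hT _ t (Nat.findGreatest_spec (P := fun n => T n ≤ t) hfl h2)

/-- A stretched exponential `exp (a j ^ b)` with `b < 1` is dominated by `R ^ j`. -/
theorem exists_exp_rpow_div_pow_le (R a b : ℝ) (hR : 1 < R) (hb : b < 1) :
    ∃ E : ℝ, 0 ≤ E ∧ ∀ j : ℕ, Real.exp (a * (j : ℝ) ^ b) / R ^ j ≤ E := by
  have hL : 0 < Real.log R := Real.log_pos hR
  have ht : Tendsto (fun x : ℝ => a * x ^ (-(1 - b))) atTop (𝓝 0) := by
    simpa using (tendsto_rpow_neg_atTop (sub_pos.2 hb)).const_mul a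
  have hev : ∀ᶠ j : ℕ in atTop, Real.exp (a * (j : ℝ) ^ b) / R ^ j ≤ 1 := by
    filter_upwards [tendsto_natCast_atTop_atTop.eventually (ht.eventually_lt_const hL),
      eventually_gt_atTop 0] with j hj hj0
    have hR0 : 0 < R := by linarith
    have hj0' : (0 : ℝ) < j := Nat.cast_pos.2 hj0
    rw [div_le_one (by positivity), ← Real.exp_log (pow_pos hR0 j), Real.exp_le_exp, Real.log_pow]
    calc a * (j : ℝ) ^ b = a * (j : ℝ) ^ (-(1 - b)) * j := by
          rw [mul_assoc, ← Real.rpow_add_one hj0'.ne']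
          ring_nf
      _ ≤ Real.log R * j := by gcongr
      _ = j * Real.log R := mul_comm _ _
  obtain ⟨E, hE⟩ := (isBoundedUnder_of_eventually_le hev).bddAbove_range
  exact ⟨max E 0, le_max_right _ _, fun j => le_max_of_le_left (hE ⟨j, rfl⟩)⟩

/-- If `|h| → ∞` at `0` from one side, then so does its infimum over shrinking one-sided punctured
neighbourhoods of `0`. -/
theorem tendsto_sInf_abs_atTop (h : ℝ → ℝ) (σ : ℝ) (hσ : σ = 1 ∨ σ = -1)
    (hblow : Tendsto (fun y : ℝ => |h y|) (nhdsWithin 0 {y : ℝ | 0 < σ * y}) atTop)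
    (ξ : ℝ → ℝ) (hξmem : ∀ z ∈ Set.Ioc (0 : ℝ) 1, ξ z ∈ Set.Ioc (0 : ℝ) 1)
    (hξ : Tendsto ξ (nhdsWithin 0 (Set.Ioi 0)) (nhds 0)) :
    Tendsto (fun z => sInf ((fun y : ℝ => |h y|) '' {y : ℝ | 0 < σ * y ∧ σ * y ≤ ξ z}))
      (𝓝[>] 0) atTop := by
  refine tendsto_atTop.2 fun M => ?_
  have hM := hblow.eventually_ge_atTop M
  rw [eventually_nhdsWithin_iff, Metric.eventually_nhds_iff] at hM
  obtain ⟨ε, hε, hM⟩ := hM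
  have h1 : ∀ᶠ z : ℝ in 𝓝[>] 0, z ∈ Set.Ioc (0 : ℝ) 1 := Ioc_mem_nhdsGT one_pos
  have hσσ : σ * σ = 1 := by rcases hσ with rfl | rfl <;> norm_num
  have habs : |σ| = 1 := by rcases hσ with rfl | rfl <;> norm_num
  filter_upwards [h1, hξ.eventually_lt_const hε] with z hz hzε
  refine le_csInf (Set.Nonempty.image _ ⟨σ * ξ z, ?_⟩) ?_
  · have := (hξmem z hz).1
    simp only [mem_ofPred_eq, ← mul_assoc, hσσ, one_mul]
    exact ⟨this, le_rfl⟩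
  · rintro _ ⟨y, ⟨hy0, hy1⟩, rfl⟩
    refine hM ?_ hy0
    have : |y| = σ * y := by rw [← abs_of_pos hy0, abs_mul, habs, one_mul]
    rw [Real.dist_eq, sub_zero, this]
    linarith

/-- (Separation lemma.) If `|h| ≤ K exp(|x|^{δ-1})` on `[-1,1] \ {0}`
and `|h(y)| → ∞` as `y → 0` on one side, then there are `ν > 0` and `ψ → ∞` such that
`sup_{(C j^{1+δ} ψ(1/z))^{-1} < |x| < 1} |h(x)|/R^j < inf_{0 < ±y ≤ ξ(z)} |h(y)|/ψ(1/z)`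
for all `j ≥ 1` and `z ∈ (0, ν]`. -/
theorem stmt17 (R C δ : ℝ) (hR : 1 < R) (hC : 1 ≤ C) (hδ : δ ∈ Set.Ioo (0 : ℝ) 1)
    (h : ℝ → ℝ) (K : ℝ) (hK : 0 < K)
    (hbound : ∀ x : ℝ, x ∈ Set.Icc (-1 : ℝ) 1 → x ≠ 0 →
      |h x| ≤ K * Real.exp (|x| ^ (-1 + δ)))
    (σ : ℝ) (hσ : σ = 1 ∨ σ = -1)
    (hblow : Tendsto (fun y : ℝ => |h y|) (nhdsWithin 0 {y : ℝ | 0 < σ * y}) atTop)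
    (ξ : ℝ → ℝ) (hξmem : ∀ z ∈ Set.Ioc (0 : ℝ) 1, ξ z ∈ Set.Ioc (0 : ℝ) 1)
    (hξ : Tendsto ξ (nhdsWithin 0 (Set.Ioi 0)) (nhds 0)) :
    ∃ ν : ℝ, 0 < ν ∧ ∃ ψ : ℝ → ℝ,
      (∀ t : ℝ, 1 ≤ t → 0 < ψ t) ∧ Tendsto ψ atTop atTop ∧
      ∀ j : ℕ, 1 ≤ j → ∀ z : ℝ, z ∈ Set.Ioc (0 : ℝ) ν →
        sSup ((fun x : ℝ => |h x| / R ^ j) ''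
            {x : ℝ | x ∈ Set.Icc (-1 : ℝ) 1 ∧
              (C * (j : ℝ) ^ (1 + δ) * ψ (1 / z))⁻¹ < |x| ∧ |x| < 1})
          < (1 / ψ (1 / z)) *
            sInf ((fun y : ℝ => |h y|) '' {y : ℝ | 0 < σ * y ∧ σ * y ≤ ξ z}) := by
  obtain ⟨hδ0, hδ1⟩ := hδ
  have hE : ∀ n : ℕ, ∃ E : ℝ, 0 ≤ E ∧ ∀ j : ℕ,
      Real.exp ((C * n) ^ (1 - δ) * (j : ℝ) ^ ((1 + δ) * (1 - δ))) / R ^ j ≤ E := fun n =>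
    exists_exp_rpow_div_pow_le R _ _ hR (by nlinarith)
  choose E hE0 hE using hE
  have hm := (tendsto_sInf_abs_atTop h σ hσ hblow ξ hξmem hξ).comp tendsto_inv_atTop_nhdsGT_zero
  obtain ⟨φ, hφ1, hφ, hev⟩ := exists_slow_tendsto_atTop _ hm (fun n => n * (K * E n))
  obtain ⟨T, hT⟩ := eventually_atTop.1 hev
  have hT1 : 0 < max T 1 := lt_max_of_lt_right one_pos
  refine ⟨(max T 1)⁻¹, inv_pos.2 hT1, fun t => φ t, fun t _ => Nat.cast_pos.2 (hφ1 t),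
    tendsto_natCast_atTop_atTop.comp hφ, fun j hj z hz => ?_⟩
  have hzT : T ≤ 1 / z := by
    rw [one_div]
    exact (le_max_left T 1).trans ((le_inv_comm₀ hz.1 hT1).1 hz.2)
  have key := hT _ hzT
  simp only [Function.comp, one_div, inv_inv] at key ⊢
  set n := φ z⁻¹
  have hn0 : (0 : ℝ) < n := Nat.cast_pos.2 (hφ1 _)
  have hj0 : (0 : ℝ) < j := Nat.cast_pos.2 hj
  have hR0 : 0 < R := by linarith
  have hC0 : 0 < C := by linarith
  refine lt_of_le_of_lt (b := K * E n) (Real.sSup_le ?_ (mul_nonneg hK.le (hE0 n))) ?_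
  · rintro _ ⟨x, ⟨hx, hxl, -⟩, rfl⟩
    have hA : 0 < C * (j : ℝ) ^ (1 + δ) * n := by positivity
    have hx0 : 0 < |x| := (inv_pos.2 hA).trans hxl
    have hpow : |x| ^ (-1 + δ) ≤ (C * n) ^ (1 - δ) * (j : ℝ) ^ ((1 + δ) * (1 - δ)) := by
      calc |x| ^ (-1 + δ) ≤ ((C * (j : ℝ) ^ (1 + δ) * n)⁻¹) ^ (-1 + δ) :=
            Real.rpow_le_rpow_of_nonpos (inv_pos.2 hA) hxl.le (by linarith)
        _ = (C * n * (j : ℝ) ^ (1 + δ)) ^ (1 - δ) := by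
            rw [Real.inv_rpow hA.le, ← Real.rpow_neg hA.le]
            congr 1 <;> ring
        _ = _ := by
            rw [Real.mul_rpow (by positivity) (by positivity), ← Real.rpow_mul hj0.le]
    calc |h x| / R ^ j
        ≤ K * Real.exp ((C * n) ^ (1 - δ) * (j : ℝ) ^ ((1 + δ) * (1 - δ))) / R ^ j := by
          have := hbound x hx (abs_pos.1 hx0)
          gcongr
          exact this.trans (by gcongr)
      _ ≤ K * E n := by
          rw [mul_div_assoc]
          exact mul_le_mul_of_nonneg_left (hE n j) hK.le
  · rwa [inv_mul_eq_div, lt_div_iff₀' hn0]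
end

section
/- Let k ∈ ℤ with k ≥ 12, and let g be a nonzero cusp form of weight k for the full modular group SL₂(ℤ), with Fourier expansion g(z) = Σ_{n≥1} a_n·e^{2πinz} for Im(z) > 0. Then: (a) for every x ∈ ℝ the series g̃(x) := Σ_{n≥1} (a_n/n^{k−1})·e^{2πinx} converges absolutely; (b) for every bounded continuous function G : ℂ → ℝ, (1/φ(q))·Σ_{a=1, gcd(a,q)=1}^{q} G(g̃(a/q)) → ∫_{[0,1]} G(g̃(x)) dx as q → ∞, where φ is Euler's totient function (i.e., the multisets {g̃(a/q) : 1 ≤ a ≤ q, gcd(a,q)=1} become distributed according to the pushforward of Lebesgue measure on [0,1] under g̃); (c) for every nonzero ℝ-linear map φ : ℂ → ℝ and every c ∈ ℝ, the set {x ∈ [0,1] : φ(g̃(x)) = c} has Lebesgue measure zero. -/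
open Filter Topology MeasureTheory Set

theorem summable_mul_exp_of_im_le {a : ℕ → ℂ} {z w : ℂ} (h : z.im ≤ w.im)
    (hz : Summable fun n : ℕ ↦ a n * Complex.exp (2 * Real.pi * Complex.I * n * z)) :
    Summable fun n : ℕ ↦ a n * Complex.exp (2 * Real.pi * Complex.I * n * w) := by
  refine Summable.of_norm_bounded hz.norm fun n ↦ ?_
  rw [norm_mul, norm_mul, Complex.norm_exp, Complex.norm_exp]
  gcongr ‖a n‖ * Real.exp ?_
  simp
  gcongr

theorem summable_of_expansion {k : ℤ}
    {g : CuspForm (⊤ : Subgroup (Matrix.SpecialLinearGroup (Fin 2) ℤ)) k} (hg : g ≠ 0)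
    {a : ℕ → ℂ} (hexp : ∀ z : UpperHalfPlane,
      g z = ∑' n : ℕ, a n * Complex.exp (2 * Real.pi * Complex.I * n * (z : ℂ)))
    (z : UpperHalfPlane) :
    Summable fun n : ℕ ↦ a n * Complex.exp (2 * Real.pi * Complex.I * n * (z : ℂ)) := by
  by_contra hz
  have hvan (w : UpperHalfPlane) (hw : w.im < z.im) : g w = 0 := by
    rw [hexp]
    exact tsum_eq_zero_of_not_summable fun h ↦ hz (summable_mul_exp_of_im_le hw.le h)
  have hdiff := UpperHalfPlane.mdifferentiable_iff.mp (ModularFormClass.holo g)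
  have han := hdiff.analyticOnNhd UpperHalfPlane.isOpen_upperHalfPlaneSet
  have hconn : IsPreconnected UpperHalfPlane.upperHalfPlaneSet :=
    (convex_halfSpace_im_gt 0).isPreconnected
  let w₀ : ℂ := ((z.im / 2 : ℝ) : ℂ) * Complex.I
  have hzpos := z.im_pos
  have hw₀ : w₀.im = z.im / 2 := by simp [w₀]
  have hev : (⇑g ∘ UpperHalfPlane.ofComplex) =ᶠ[𝓝 w₀] 0 := by
    have h1 : ∀ᶠ w in 𝓝 w₀, w.im < z.im :=
      (isOpen_lt Complex.continuous_im continuous_const).mem_nhds (by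
        show w₀.im < z.im
        rw [hw₀]; linarith)
    have h2 : ∀ᶠ w in 𝓝 w₀, 0 < w.im :=
      (isOpen_lt continuous_const Complex.continuous_im).mem_nhds (by
        show 0 < w₀.im
        rw [hw₀]; linarith)
    filter_upwards [h1, h2] with w hw1 hw2
    simp only [Function.comp_apply, Pi.zero_apply]
    apply hvan
    rw [UpperHalfPlane.ofComplex_apply_of_im_pos hw2]
    exact hw1
  have hzero := han.eqOn_zero_of_preconnected_of_eventuallyEq_zero hconn
    (show w₀ ∈ UpperHalfPlane.upperHalfPlaneSet by
      show 0 < w₀.im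
      rw [hw₀]; linarith) hev
  apply hg
  ext w
  have := hzero w.im_pos
  simpa using this

theorem exists_norm_coeff_le {k : ℤ}
    {g : CuspForm (⊤ : Subgroup (Matrix.SpecialLinearGroup (Fin 2) ℤ)) k} (hg : g ≠ 0)
    {a : ℕ → ℂ} (ha0 : a 0 = 0) (hexp : ∀ z : UpperHalfPlane,
      g z = ∑' n : ℕ, a n * Complex.exp (2 * Real.pi * Complex.I * n * (z : ℂ))) :
    ∃ C, ∀ n : ℕ, ‖a n‖ ≤ C * (n : ℝ) ^ ((k : ℝ) / 2) := by
  have hT : ModularGroup.T ∈ (⊤ : Subgroup (Matrix.SpecialLinearGroup (Fin 2) ℤ)) :=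
    Subgroup.mem_top _
  have hw := Subgroup.strictWidthInfty_eq_one_of_T_mem hT
  have hΓ : (1 : ℝ) ∈ Subgroup.strictPeriods
      ((⊤ : Subgroup (Matrix.SpecialLinearGroup (Fin 2) ℤ)) : Subgroup (GL (Fin 2) ℝ)) := by
    rw [Subgroup.strictPeriods_eq_zmultiples_one_of_T_mem hT]
    exact AddSubgroup.mem_zmultiples 1
  have hcoef (n : ℕ) : a n = (UpperHalfPlane.qExpansion 1 g).coeff n := by
    refine ModularFormClass.qExpansion_coeff_unique one_pos hΓ (fun τ ↦ ?_) n
    have := (summable_of_expansion hg hexp τ).hasSum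
    rw [← hexp] at this
    convert this using 2 with m
    rw [smul_eq_mul, Function.Periodic.qParam, ← Complex.exp_nat_mul]
    congr 2
    push_cast
    ring
  have hO := CuspFormClass.qExpansion_isBigO g
  rw [hw] at hO
  simp_rw [← hcoef] at hO
  obtain ⟨C, hC, hb⟩ := Asymptotics.bound_of_isBigO_nat_atTop hO
  refine ⟨C, fun n ↦ ?_⟩
  rcases eq_or_ne n 0 with rfl | hn
  · rw [ha0, norm_zero]
    positivity
  · have := hb (x := n) (by positivity)
    rwa [Real.norm_of_nonneg (by positivity)] at this

theorem exists_norm_coeff_div_le {k : ℤ} (hk : 12 ≤ k) {a : ℕ → ℂ}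
    (h : ∃ C, ∀ n : ℕ, ‖a n‖ ≤ C * (n : ℝ) ^ ((k : ℝ) / 2)) :
    ∃ C, ∀ n : ℕ, ‖a n / (n : ℂ) ^ (k - 1)‖ ≤ C * (1 / (n : ℝ) ^ 2) := by
  obtain ⟨C, hC⟩ := h
  have hC0 : 0 ≤ C := by simpa using (norm_nonneg _).trans (hC 1)
  refine ⟨C, fun n ↦ ?_⟩
  rcases eq_or_ne n 0 with rfl | hn
  · simp [zero_zpow (k - 1) (by lia)]
  have hn1 : (1 : ℝ) ≤ n := by exact_mod_cast Nat.one_le_iff_ne_zero.mpr hn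
  rw [norm_div, norm_zpow, Complex.norm_natCast, div_le_iff₀ (by positivity)]
  refine (hC n).trans ?_
  rw [mul_assoc]
  gcongr
  rw [one_div_mul_eq_div, le_div_iff₀ (by positivity), ← Real.rpow_natCast, ← Real.rpow_intCast,
    ← Real.rpow_add (by positivity)]
  apply Real.rpow_le_rpow_of_exponent_le hn1
  have : (12 : ℝ) ≤ k := by exact_mod_cast hk
  push_cast
  linarith

/-- The series `Σ b n e(nz)`. -/
noncomputable def qSeries (b : ℕ → ℂ) (z : ℂ) : ℂ :=
  ∑' n : ℕ, b n * Complex.exp (2 * Real.pi * Complex.I * n * z)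

theorem norm_exp_two_pi_I_mul (n : ℕ) (z : ℂ) :
    ‖Complex.exp (2 * Real.pi * Complex.I * n * z)‖ = Real.exp (-(2 * Real.pi * z.im) * n) := by
  rw [Complex.norm_exp]
  congr 1
  simp
  ring

theorem norm_exp_two_pi_I_mul_le_one (n : ℕ) {z : ℂ} (hz : 0 ≤ z.im) :
    ‖Complex.exp (2 * Real.pi * Complex.I * n * z)‖ ≤ 1 := by
  rw [norm_exp_two_pi_I_mul, Real.exp_le_one_iff]
  have : 0 ≤ 2 * Real.pi * z.im * n := by positivity
  linarith

theorem norm_mul_exp_le (b : ℕ → ℂ) (n : ℕ) {z : ℂ} (hz : 0 ≤ z.im) :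
    ‖b n * Complex.exp (2 * Real.pi * Complex.I * n * z)‖ ≤ ‖b n‖ := by
  rw [norm_mul]
  exact mul_le_of_le_one_right (norm_nonneg _) (norm_exp_two_pi_I_mul_le_one n hz)

theorem continuousOn_qSeries {b : ℕ → ℂ} (hb : Summable fun n ↦ ‖b n‖) :
    ContinuousOn (qSeries b) {z | 0 ≤ z.im} := by
  refine continuousOn_tsum (fun n ↦ by fun_prop) hb fun n z hz ↦ norm_mul_exp_le b n hz

theorem hasDerivAt_qSeries {b : ℕ → ℂ} {C : ℝ} {m : ℕ} (hb : ∀ n : ℕ, ‖b n‖ ≤ C * (n : ℝ) ^ m)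
    {z : ℂ} (hz : 0 < z.im) :
    HasDerivAt (qSeries b) (qSeries (fun n ↦ 2 * Real.pi * Complex.I * n * b n) z) z := by
  have hbound (m : ℕ) (C y : ℝ) (hy : 0 < y) (b : ℕ → ℂ) (hb : ∀ n : ℕ, ‖b n‖ ≤ C * (n : ℝ) ^ m)
      (n : ℕ) (w : ℂ) (hw : y ≤ w.im) :
      ‖b n * Complex.exp (2 * Real.pi * Complex.I * n * w)‖ ≤
        C * ((n : ℝ) ^ m * Real.exp (-(2 * Real.pi * y) * n)) := by
    rw [norm_mul, norm_exp_two_pi_I_mul, ← mul_assoc]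
    refine mul_le_mul (hb n) ?_ (Real.exp_nonneg _) ((norm_nonneg _).trans (hb n))
    rw [Real.exp_le_exp]
    have : 2 * Real.pi * y * n ≤ 2 * Real.pi * w.im * n := by gcongr
    linarith
  have hsum (m : ℕ) (C y : ℝ) (hy : 0 < y) :
      Summable fun n : ℕ ↦ C * ((n : ℝ) ^ m * Real.exp (-(2 * Real.pi * y) * n)) :=
    (Real.summable_pow_mul_exp_neg_nat_mul m (by positivity)).mul_left C
  have hb' (n : ℕ) : ‖2 * Real.pi * Complex.I * n * b n‖ ≤ (2 * Real.pi * C) * (n : ℝ) ^ (m + 1) := by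
    have := hb n
    simp only [norm_mul, Complex.norm_ofNat, Complex.norm_real, Complex.norm_I, mul_one,
      Complex.norm_natCast, Real.norm_of_nonneg Real.pi_pos.le]
    calc 2 * Real.pi * n * ‖b n‖ ≤ 2 * Real.pi * n * (C * (n : ℝ) ^ m) := by gcongr
      _ = _ := by ring
  have hy : 0 < z.im / 2 := by positivity
  have hzm : z ∈ {w : ℂ | z.im / 2 < w.im} := by
    show z.im / 2 < z.im
    linarith
  refine hasDerivAt_tsum_of_isPreconnected
    (g := fun n w ↦ b n * Complex.exp (2 * Real.pi * Complex.I * n * w))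
    (g' := fun n w ↦ 2 * Real.pi * Complex.I * n * b n *
      Complex.exp (2 * Real.pi * Complex.I * n * w)) (t := {w : ℂ | z.im / 2 < w.im})
    (hsum (m + 1) (2 * Real.pi * C) (z.im / 2) hy)
    (isOpen_lt continuous_const Complex.continuous_im) (convex_halfSpace_im_gt _).isPreconnected
    (fun n w _ ↦ ?_) (fun n w hw ↦ ?_) hzm ?_ hzm
  · have h1 : HasDerivAt (fun w : ℂ ↦ 2 * Real.pi * Complex.I * n * w)
        (2 * Real.pi * Complex.I * n) w := by
      simpa using (hasDerivAt_id w).const_mul (2 * Real.pi * Complex.I * n : ℂ)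
    exact (h1.cexp.const_mul (b n)).congr_deriv (by ring)
  · exact hbound (m + 1) _ _ hy _ hb' n w (le_of_lt hw)
  · exact Summable.of_norm_bounded (hsum m C z.im hz) fun n ↦ hbound m C z.im hz b hb n z le_rfl

/-- `F` is an `n`-fold complex derivative of `f` on the upper half-plane. -/
def IsIterDeriv : ℕ → (ℂ → ℂ) → (ℂ → ℂ) → Prop
  | 0, f, F => ∀ z : ℂ, 0 < z.im → f z = F z
  | n + 1, f, F => ∃ f' : ℂ → ℂ, (∀ z : ℂ, 0 < z.im → HasDerivAt f (f' z) z) ∧ IsIterDeriv n f' F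

namespace IsIterDeriv

theorem of_chain {f : ℕ → ℂ → ℂ} :
    ∀ (n : ℕ), (∀ i z, 0 < z.im → HasDerivAt (f i) (f (i + 1) z) z) → IsIterDeriv n (f 0) (f n)
  | 0, _ => fun _ _ ↦ rfl
  | n + 1, h => ⟨f 1, h 0, of_chain (f := fun i ↦ f (i + 1)) n fun i ↦ h (i + 1)⟩

theorem congr_right {F G : ℂ → ℂ} (hFG : ∀ z : ℂ, 0 < z.im → F z = G z) :
    ∀ {n : ℕ} {f : ℂ → ℂ}, IsIterDeriv n f F → IsIterDeriv n f G
  | 0, _, h => fun z hz ↦ (h z hz).trans (hFG z hz)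
  | _ + 1, _, ⟨f', h, h'⟩ => ⟨f', h, h'.congr_right hFG⟩

theorem congr_left {f g F : ℂ → ℂ} (hfg : ∀ z : ℂ, 0 < z.im → f z = g z) :
    ∀ {n : ℕ}, IsIterDeriv n f F → IsIterDeriv n g F
  | 0, h => fun z hz ↦ (hfg z hz).symm.trans (h z hz)
  | _ + 1, ⟨f', h, h'⟩ => ⟨f', fun z hz ↦ (h z hz).congr_of_eventuallyEq (by
      filter_upwards [(isOpen_lt continuous_const Complex.continuous_im).mem_nhds hz] with w hw
      exact (hfg w hw).symm), h'⟩

theorem add_smul (c : ℂ) : ∀ {n : ℕ} {f g F G : ℂ → ℂ}, IsIterDeriv n f F → IsIterDeriv n g G →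
    IsIterDeriv n (fun z ↦ f z + c * g z) (fun z ↦ F z + c * G z)
  | 0, _, _, _, _, hf, hg => fun z hz ↦ by simp only [hf z hz, hg z hz]
  | _ + 1, _, _, _, _, ⟨f', hf, hf'⟩, ⟨g', hg, hg'⟩ =>
    ⟨fun z ↦ f' z + c * g' z, fun z hz ↦ (hf z hz).add ((hg z hz).const_mul c),
      hf'.add_smul c hg'⟩

theorem affine_mul (c d : ℂ) {F G : ℂ → ℂ} (hFG : ∀ z : ℂ, 0 < z.im → HasDerivAt F (G z) z) :
    ∀ {n : ℕ} {f : ℂ → ℂ}, IsIterDeriv n f F →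
      IsIterDeriv (n + 1) (fun z ↦ (c * z + d) * f z)
        (fun z ↦ (c * z + d) * G z + (n + 1) * c * F z) := by
  have haff (z : ℂ) : HasDerivAt (fun z ↦ c * z + d) c z := by
    simpa using ((hasDerivAt_id z).const_mul c).add_const d
  intro n
  induction n with
  | zero =>
    intro f h
    refine IsIterDeriv.congr_left (f := fun z ↦ (c * z + d) * F z)
      (fun z hz ↦ by rw [h z hz]) ⟨_, fun z hz ↦ (haff z).mul (hFG z hz), fun z _ ↦ ?_⟩
    push_cast
    ring
  | succ n ih =>
    rintro f ⟨f', hf, hf'⟩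
    refine ⟨fun z ↦ (c * z + d) * f' z + c * f z, fun z hz ↦ ?_, ?_⟩
    · exact ((haff z).mul (hf z hz)).congr_deriv (by ring)
    · refine ((ih hf').add_smul c (show IsIterDeriv (n + 1) f F from ⟨f', hf, hf'⟩)).congr_right
        fun z _ ↦ ?_
      push_cast
      ring

theorem exists_polynomial : ∀ {n : ℕ} {f : ℂ → ℂ}, IsIterDeriv n f (fun _ ↦ 0) →
    ∃ p : Polynomial ℂ, ∀ z : ℂ, 0 < z.im → f z = p.eval z
  | 0, f, h => ⟨0, fun z hz ↦ by simpa using h z hz⟩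
  | n + 1, f, ⟨f', h, h'⟩ => by
    obtain ⟨p, hp⟩ := h'.exists_polynomial
    obtain ⟨P, hP⟩ : ∃ P : Polynomial ℂ, P.derivative = p := by
      refine ⟨p.sum fun i c ↦ Polynomial.monomial (i + 1) (c / (i + 1)), ?_⟩
      conv_rhs => rw [← p.sum_monomial_eq]
      simp only [Polynomial.sum, Polynomial.derivative_sum]
      refine Finset.sum_congr rfl fun i _ ↦ ?_
      rw [Polynomial.derivative_monomial]
      have : (i : ℂ) + 1 ≠ 0 := Nat.cast_add_one_ne_zero i
      congr 1
      push_cast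
      field_simp
    have hopen : IsOpen {z : ℂ | 0 < z.im} := isOpen_lt continuous_const Complex.continuous_im
    have hd (z : ℂ) (hz : 0 < z.im) : HasDerivAt (fun w ↦ f w - P.eval w) 0 z := by
      have := (h z hz).sub (P.hasDerivAt z)
      rwa [hP, hp z hz, sub_self] at this
    obtain ⟨c, hc⟩ := hopen.exists_is_const_of_deriv_eq_zero
      (convex_halfSpace_im_gt 0).isPreconnected
      (fun z hz ↦ (hd z hz).differentiableAt.differentiableWithinAt)
      (fun z hz ↦ (hd z hz).deriv)
    refine ⟨P + Polynomial.C c, fun z hz ↦ ?_⟩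
    have := hc z hz
    simp [← this]

/-- Bol's identity. -/
theorem bol {f : ℕ → ℂ → ℂ} (hf : ∀ i z, 0 < z.im → HasDerivAt (f i) (f (i + 1) z) z)
    {a b c d : ℂ} (hdet : a * d - b * c = 1) (hne : ∀ z : ℂ, 0 < z.im → c * z + d ≠ 0)
    (him : ∀ z : ℂ, 0 < z.im → 0 < ((a * z + b) / (c * z + d)).im) (n : ℕ) :
    IsIterDeriv (n + 1) (fun z ↦ (c * z + d) ^ n * f 0 ((a * z + b) / (c * z + d)))
      (fun z ↦ ((c * z + d) ^ (n + 2))⁻¹ * f (n + 1) ((a * z + b) / (c * z + d))) := by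
  have haff (c d z : ℂ) : HasDerivAt (fun z ↦ c * z + d) c z := by
    simpa using ((hasDerivAt_id z).const_mul c).add_const d
  have hmob (z : ℂ) (hz : 0 < z.im) :
      HasDerivAt (fun z ↦ (a * z + b) / (c * z + d)) (((c * z + d) ^ 2)⁻¹) z := by
    refine ((haff a b z).div (haff c d z) (hne z hz)).congr_deriv ?_
    rw [inv_eq_one_div, ← hdet]
    congr 1
    ring
  have hcomp (i : ℕ) (z : ℂ) (hz : 0 < z.im) :
      HasDerivAt (fun z ↦ f i ((a * z + b) / (c * z + d)))
        (f (i + 1) ((a * z + b) / (c * z + d)) * ((c * z + d) ^ 2)⁻¹) z :=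
    (hf i _ (him z hz)).comp z (hmob z hz)
  induction n with
  | zero =>
    refine IsIterDeriv.congr_left (f := fun z ↦ f 0 ((a * z + b) / (c * z + d))) (by simp)
      ⟨_, hcomp 0, fun z _ ↦ by simp [mul_comm]⟩
  | succ n ih =>
    have hV (z : ℂ) (hz : 0 < z.im) :
        HasDerivAt (fun z ↦ ((c * z + d) ^ (n + 2))⁻¹ * f (n + 1) ((a * z + b) / (c * z + d)))
          (((c * z + d) ^ (n + 4))⁻¹ * f (n + 2) ((a * z + b) / (c * z + d)) -
            (n + 2) * c * ((c * z + d) ^ (n + 3))⁻¹ * f (n + 1) ((a * z + b) / (c * z + d))) z := by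
      have hj := hne z hz
      have hinv : HasDerivAt (fun z ↦ ((c * z + d) ^ (n + 2))⁻¹)
          (-((n + 2) * c * ((c * z + d) ^ (n + 3))⁻¹)) z := by
        refine (((haff c d z).fun_pow (n + 2)).fun_inv (pow_ne_zero _ hj)).congr_deriv ?_
        simp only [Nat.add_succ_sub_one]
        push_cast
        field_simp
        ring
      refine (hinv.mul (hcomp (n + 1) z hz)).congr_deriv ?_
      generalize f (n + 1) ((a * z + b) / (c * z + d)) = u
      rw [show n + 1 + 1 = n + 2 from rfl]
      generalize f (n + 2) ((a * z + b) / (c * z + d)) = v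
      field_simp
      ring
    refine ((ih.affine_mul c d hV).congr_left fun z _ ↦ ?_).congr_right fun z hz ↦ ?_
    · ring
    · have := hne z hz
      generalize f (n + 1) ((a * z + b) / (c * z + d)) = u
      rw [show n + 1 + 1 = n + 2 from rfl]
      generalize f (n + 2) ((a * z + b) / (c * z + d)) = v
      push_cast
      field_simp
      ring

end IsIterDeriv

theorem isIterDeriv_bol_sub {n : ℕ} {k : ℤ} (hkn : k = n + 2)
    (g : CuspForm (⊤ : Subgroup (Matrix.SpecialLinearGroup (Fin 2) ℤ)) k)
    {b : ℕ → ℂ} {C : ℝ} (hb : ∀ m : ℕ, ‖b m‖ ≤ C)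
    (hexp : ∀ z : UpperHalfPlane, g z = qSeries (fun m ↦ (m : ℂ) ^ (n + 1) * b m) z)
    (γ : Matrix.SpecialLinearGroup (Fin 2) ℤ) :
    IsIterDeriv (n + 1) (fun z ↦ ((γ 1 0 : ℂ) * z + γ 1 1) ^ n *
        qSeries b (((γ 0 0 : ℂ) * z + γ 0 1) / ((γ 1 0 : ℂ) * z + γ 1 1)) - qSeries b z)
      (fun _ ↦ 0) := by
  let f (i : ℕ) : ℂ → ℂ := qSeries fun m ↦ (2 * Real.pi * Complex.I * m) ^ i * b m
  have hf (i : ℕ) (z : ℂ) (hz : 0 < z.im) : HasDerivAt (f i) (f (i + 1) z) z := by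
    have hbd (m : ℕ) : ‖(2 * Real.pi * Complex.I * m) ^ i * b m‖ ≤
        ((2 * Real.pi) ^ i * C) * (m : ℝ) ^ i := by
      simp only [norm_mul, norm_pow, Complex.norm_ofNat, Complex.norm_real, Complex.norm_I, mul_one,
        Complex.norm_natCast, Real.norm_of_nonneg Real.pi_pos.le]
      calc (2 * Real.pi * m) ^ i * ‖b m‖ ≤ (2 * Real.pi * m) ^ i * C := by gcongr; exact hb m
        _ = _ := by ring
    refine (hasDerivAt_qSeries hbd hz).congr_deriv (tsum_congr fun m ↦ ?_)
    ring
  have hf0 : f 0 = qSeries b := by simp [f]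
  have hfg (z : UpperHalfPlane) : f (n + 1) z = (2 * Real.pi * Complex.I) ^ (n + 1) * g z := by
    rw [hexp, qSeries, ← tsum_mul_left]
    refine tsum_congr fun m ↦ ?_
    ring
  have hsmul (z : UpperHalfPlane) : ((γ • z : UpperHalfPlane) : ℂ) =
      ((γ 0 0 : ℂ) * z + γ 0 1) / ((γ 1 0 : ℂ) * z + γ 1 1) := by
    simpa using UpperHalfPlane.coe_specialLinearGroup_apply γ z
  have hne (z : ℂ) (hz : 0 < z.im) : (γ 1 0 : ℂ) * z + γ 1 1 ≠ 0 := by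
    simpa [UpperHalfPlane.denom] using UpperHalfPlane.denom_ne_zero γ ⟨z, hz⟩
  have him (z : ℂ) (hz : 0 < z.im) :
      0 < (((γ 0 0 : ℂ) * z + γ 0 1) / ((γ 1 0 : ℂ) * z + γ 1 1)).im := by
    rw [← hsmul ⟨z, hz⟩]
    exact UpperHalfPlane.im_pos _
  have hdet : (γ 0 0 : ℂ) * γ 1 1 - γ 0 1 * γ 1 0 = 1 := by
    have := γ.det_coe
    rw [Matrix.det_fin_two] at this
    exact_mod_cast this
  have hbol := (IsIterDeriv.bol hf hdet hne him n).add_smul (-1) (IsIterDeriv.of_chain (n + 1) hf)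
  refine (hbol.congr_left fun z _ ↦ ?_).congr_right fun z hz ↦ ?_
  · rw [hf0]
    ring
  · have hmod := SlashInvariantForm.slash_action_eqn_SL'' g (Subgroup.mem_top γ) ⟨z, hz⟩
    have hj := hne z hz
    rw [← hsmul ⟨z, hz⟩, hfg, hmod, show f (n + 1) z = _ from hfg ⟨z, hz⟩]
    have hd : UpperHalfPlane.denom γ ((⟨z, hz⟩ : UpperHalfPlane) : ℂ) = (γ 1 0 : ℂ) * z + γ 1 1 := by
      simp [UpperHalfPlane.denom]
    have hpow : ((γ 1 0 : ℂ) * z + γ 1 1) ^ k = ((γ 1 0 : ℂ) * z + γ 1 1) ^ (n + 2) := by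
      rw [hkn, ← zpow_natCast]
      norm_cast
    rw [hd, hpow]
    field_simp
    ring

/-- The Eichler integral transforms on the real line up to a polynomial. -/
theorem exists_period_polynomial {n : ℕ} {k : ℤ} (hkn : k = n + 2)
    (g : CuspForm (⊤ : Subgroup (Matrix.SpecialLinearGroup (Fin 2) ℤ)) k)
    {b : ℕ → ℂ} (hb : Summable fun m ↦ ‖b m‖)
    (hexp : ∀ z : UpperHalfPlane, g z = qSeries (fun m ↦ (m : ℂ) ^ (n + 1) * b m) z)
    (γ : Matrix.SpecialLinearGroup (Fin 2) ℤ) :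
    ∃ P : Polynomial ℂ, ∀ y : ℝ, (γ 1 0 : ℝ) * y + γ 1 1 ≠ 0 →
      (((γ 1 0 : ℝ) * y + γ 1 1 : ℝ) : ℂ) ^ n *
        qSeries b ((((γ 0 0 : ℝ) * y + γ 0 1) / ((γ 1 0 : ℝ) * y + γ 1 1) : ℝ) : ℂ) =
      qSeries b y + P.eval (y : ℂ) := by
  obtain ⟨P, hP⟩ := (isIterDeriv_bol_sub hkn g
    (fun m ↦ hb.le_tsum m fun _ _ ↦ norm_nonneg _) hexp γ).exists_polynomial
  refine ⟨P, fun y hy ↦ ?_⟩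
  have hcont := continuousOn_qSeries hb
  have hpath : Tendsto (fun t : ℝ ↦ (y : ℂ) + t * Complex.I) (𝓝[>] 0) (𝓝 y) := by
    have : Continuous fun t : ℝ ↦ (y : ℂ) + t * Complex.I := by fun_prop
    simpa using (this.tendsto 0).mono_left nhdsWithin_le_nhds
  have hpos : ∀ᶠ t : ℝ in 𝓝[>] 0, 0 < ((y : ℂ) + t * Complex.I).im := by
    filter_upwards [self_mem_nhdsWithin] with t ht
    simpa using ht
  have hyc : (γ 1 0 : ℂ) * y + γ 1 1 ≠ 0 := by exact_mod_cast hy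
  have hmob : Tendsto (fun z : ℂ ↦ ((γ 0 0 : ℂ) * z + γ 0 1) / ((γ 1 0 : ℂ) * z + γ 1 1)) (𝓝 (y : ℂ))
      (𝓝 (((γ 0 0 : ℂ) * y + γ 0 1) / ((γ 1 0 : ℂ) * y + γ 1 1))) :=
    ContinuousAt.tendsto (by fun_prop (disch := exact hyc))
  have himmob : ∀ᶠ t : ℝ in 𝓝[>] 0, 0 ≤ (((γ 0 0 : ℂ) * (y + t * Complex.I) + γ 0 1) /
      ((γ 1 0 : ℂ) * (y + t * Complex.I) + γ 1 1)).im := by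
    filter_upwards [hpos] with t ht
    have := (γ • (⟨_, ht⟩ : UpperHalfPlane)).im_pos.le
    rw [← UpperHalfPlane.coe_im, UpperHalfPlane.coe_specialLinearGroup_apply] at this
    simpa using this
  have hlim1 : Tendsto (fun t : ℝ ↦ qSeries b (((γ 0 0 : ℂ) * (y + t * Complex.I) + γ 0 1) /
      ((γ 1 0 : ℂ) * (y + t * Complex.I) + γ 1 1))) (𝓝[>] 0)
      (𝓝 (qSeries b (((γ 0 0 : ℂ) * y + γ 0 1) / ((γ 1 0 : ℂ) * y + γ 1 1)))) := by
    refine (hcont _ ?_).tendsto.comp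
      (tendsto_nhdsWithin_iff.mpr ⟨hmob.comp hpath, himmob⟩)
    have : (((γ 0 0 : ℂ) * y + γ 0 1) / ((γ 1 0 : ℂ) * y + γ 1 1)) =
      ((((γ 0 0 : ℝ) * y + γ 0 1) / ((γ 1 0 : ℝ) * y + γ 1 1) : ℝ) : ℂ) := by push_cast; rfl
    rw [this]
    exact (Complex.ofReal_im _).ge
  have hlim2 : Tendsto (fun t : ℝ ↦ qSeries b (y + t * Complex.I)) (𝓝[>] 0) (𝓝 (qSeries b y)) :=
    (hcont y (by simp)).tendsto.comp
      (tendsto_nhdsWithin_iff.mpr ⟨hpath, hpos.mono fun _ h ↦ le_of_lt h⟩)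
  have hlim3 : Tendsto (fun t : ℝ ↦ ((γ 1 0 : ℂ) * (y + t * Complex.I) + γ 1 1) ^ n) (𝓝[>] 0)
      (𝓝 (((γ 1 0 : ℂ) * y + γ 1 1) ^ n)) :=
    ((hpath.const_mul _).add_const _).pow n
  have hlim4 := (P.continuous.tendsto (y : ℂ)).comp hpath
  have key := tendsto_nhds_unique (((hlim3.mul hlim1).sub hlim2).congr' (by
    filter_upwards [hpos] with t ht
    exact hP _ ht)) hlim4
  push_cast
  rw [← key]
  ring

theorem tendsto_totient_atTop : Tendsto Nat.totient atTop atTop := by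
  rw [tendsto_atTop]
  intro N
  filter_upwards [eventually_gt_atTop (((N + 1).factorial) ^ (N + 1))] with q hq
  by_contra! hN
  have hq0 : 0 < q := by lia
  have hφ : 0 < q.totient := Nat.totient_pos.mpr hq0
  refine absurd (Nat.le_of_dvd (by positivity) ?_) hq.not_ge
  refine (Nat.dvd_iff_prime_pow_dvd_dvd _ _).mpr fun p e hp hpe ↦ ?_
  rcases Nat.eq_zero_or_pos e with rfl | he
  · simp
  have hle : p ^ (e - 1) * (p - 1) ≤ N := by
    rw [← Nat.totient_prime_pow hp he]
    exact (Nat.le_of_dvd hφ (Nat.totient_dvd_of_dvd hpe)).trans hN.le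
  have hp2 := hp.two_le
  have hpN : p ≤ N + 1 := by
    have : 1 * (p - 1) ≤ p ^ (e - 1) * (p - 1) := Nat.mul_le_mul_right _ (Nat.one_le_pow _ _ (by lia))
    lia
  have heN : e ≤ N + 1 := by
    have h1 : e - 1 < p ^ (e - 1) := Nat.lt_pow_self hp.one_lt
    have h2 : p ^ (e - 1) * 1 ≤ p ^ (e - 1) * (p - 1) := Nat.mul_le_mul_left _ (by lia)
    lia
  exact (pow_dvd_pow_of_dvd ((Nat.Prime.dvd_factorial hp).mpr hpN) e).trans (pow_dvd_pow _ heN)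

theorem sum_Icc_eq_sum_divisors_coprime {R : Type*} [AddCommMonoid R] (f : ℝ → R) {q : ℕ}
    (hq : 0 < q) :
    ∑ b ∈ Finset.Icc 1 q, f ((b : ℝ) / q) =
      ∑ d ∈ q.divisors, ∑ c ∈ (Finset.Icc 1 d).filter fun c ↦ Nat.Coprime c d, f ((c : ℝ) / d) := by
  rw [Finset.sum_sigma']
  refine Finset.sum_bij' (fun b _ ↦ ⟨q / b.gcd q, b / b.gcd q⟩) (fun x _ ↦ x.2 * (q / x.1))
    ?_ ?_ ?_ ?_ ?_
  · intro b hb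
    rw [Finset.mem_Icc] at hb
    have hg : 0 < b.gcd q := Nat.gcd_pos_of_pos_right _ hq
    simp only [Finset.mem_sigma, Nat.mem_divisors, Finset.mem_filter, Finset.mem_Icc]
    exact ⟨⟨Nat.div_dvd_of_dvd (Nat.gcd_dvd_right _ _), hq.ne'⟩,
      ⟨Nat.div_pos (Nat.le_of_dvd (by lia) (Nat.gcd_dvd_left _ _)) hg, Nat.div_le_div_right hb.2⟩,
      Nat.coprime_div_gcd_div_gcd hg⟩
  · rintro ⟨d, c⟩ hx
    simp only [Finset.mem_sigma, Nat.mem_divisors, Finset.mem_filter, Finset.mem_Icc] at hx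
    obtain ⟨⟨⟨e, rfl⟩, -⟩, ⟨hc, hcd⟩, -⟩ := hx
    have hd : 0 < d := by lia
    have he : 0 < e := Nat.pos_of_mul_pos_left hq
    rw [Finset.mem_Icc, Nat.mul_div_cancel_left _ hd]
    exact ⟨Nat.mul_pos hc he, Nat.mul_le_mul_right _ hcd⟩
  · intro b hb
    simp only
    rw [Nat.div_div_self (Nat.gcd_dvd_right _ _) hq.ne']
    exact Nat.div_mul_cancel (Nat.gcd_dvd_left _ _)
  · rintro ⟨d, c⟩ hx
    simp only [Finset.mem_sigma, Nat.mem_divisors, Finset.mem_filter, Finset.mem_Icc] at hx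
    obtain ⟨⟨⟨e, rfl⟩, -⟩, ⟨hc, hcd⟩, hco⟩ := hx
    have hd : 0 < d := by lia
    have he : 0 < e := Nat.pos_of_mul_pos_left hq
    have hgcd : (c * e).gcd (d * e) = e := by rw [Nat.gcd_mul_right, hco.gcd_eq_one, one_mul]
    simp only [Nat.mul_div_cancel_left _ hd, hgcd, Nat.mul_div_cancel _ he]
  · intro b hb
    have hg : ((b.gcd q : ℕ) : ℝ) ≠ 0 := by exact_mod_cast (Nat.gcd_pos_of_pos_right _ hq).ne'
    simp only
    rw [Nat.cast_div (Nat.gcd_dvd_right _ _) hg, Nat.cast_div (Nat.gcd_dvd_left _ _) hg,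
      div_div_div_cancel_right₀ hg]

theorem sum_exp_Icc (n : ℤ) {q : ℕ} (hq : 0 < q) :
    ∑ b ∈ Finset.Icc 1 q, Complex.exp (2 * Real.pi * Complex.I * n * ((b : ℝ) / q : ℝ)) =
      if (q : ℤ) ∣ n then (q : ℂ) else 0 := by
  have hqc : (q : ℂ) ≠ 0 := by exact_mod_cast hq.ne'
  have hpow (b : ℕ) : Complex.exp (2 * Real.pi * Complex.I * n * ((b : ℝ) / q : ℝ)) =
      Complex.exp (2 * Real.pi * Complex.I * (n / q)) ^ b := by
    rw [← Complex.exp_nat_mul]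
    congr 1
    push_cast
    ring
  simp_rw [hpow]
  have hone : Complex.exp (2 * Real.pi * Complex.I * (n / q)) = 1 ↔ (q : ℤ) ∣ n := by
    rw [Complex.exp_eq_one_iff]
    have hpi := Complex.two_pi_I_ne_zero
    constructor
    · rintro ⟨m, hm⟩
      refine ⟨m, ?_⟩
      have : (n : ℂ) / q = m := mul_left_cancel₀ hpi (by linear_combination hm)
      rw [div_eq_iff hqc] at this
      have h2 : (n : ℂ) = ((q * m : ℤ) : ℂ) := by
        push_cast
        linear_combination this
      exact_mod_cast h2
    · rintro ⟨m, rfl⟩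
      refine ⟨m, ?_⟩
      push_cast
      field_simp
  split_ifs with h
  · simp [hone.mpr h]
  · have hne := mt hone.mp h
    have hroot : Complex.exp (2 * Real.pi * Complex.I * (n / q)) ^ q = 1 := by
      rw [← Complex.exp_nat_mul, Complex.exp_eq_one_iff]
      exact ⟨n, by field_simp⟩
    have : Finset.Icc 1 q = Finset.Ico 1 (q + 1) := by ext; simp
    rw [this, geom_sum_Ico hne (by lia), pow_succ, hroot]
    simp

/-- Ramanujan sums of a fixed nonzero argument are bounded. -/
theorem norm_sum_exp_coprime_le {n : ℤ} (hn : n ≠ 0) {q : ℕ} (hq : 0 < q) :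
    ‖∑ b ∈ (Finset.Icc 1 q).filter fun b ↦ Nat.Coprime b q,
      Complex.exp (2 * Real.pi * Complex.I * n * ((b : ℝ) / q : ℝ))‖ ≤
      ∑ d ∈ n.natAbs.divisors, (d : ℝ) := by
  have h := (ArithmeticFunction.sum_eq_iff_sum_mul_moebius_eq
    (f := fun q : ℕ ↦ ∑ b ∈ (Finset.Icc 1 q).filter fun b ↦ Nat.Coprime b q,
      Complex.exp (2 * Real.pi * Complex.I * n * ((b : ℝ) / q : ℝ)))
    (g := fun q : ℕ ↦ if (q : ℤ) ∣ n then (q : ℂ) else 0)).mp (fun m hm ↦ by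
      rw [← sum_exp_Icc n hm]
      exact (sum_Icc_eq_sum_divisors_coprime
        (fun x : ℝ ↦ Complex.exp (2 * Real.pi * Complex.I * n * x)) hm).symm) q hq
  rw [← h]
  refine (norm_sum_le _ _).trans ?_
  calc ∑ x ∈ q.divisorsAntidiagonal, ‖((ArithmeticFunction.moebius x.1 : ℤ) : ℂ) *
          (if (x.2 : ℤ) ∣ n then (x.2 : ℂ) else 0)‖
      ≤ ∑ x ∈ q.divisorsAntidiagonal, if (x.2 : ℤ) ∣ n then (x.2 : ℝ) else 0 := by
        refine Finset.sum_le_sum fun x _ ↦ ?_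
        have hμ : |((ArithmeticFunction.moebius x.1 : ℤ) : ℝ)| ≤ 1 := by
          exact_mod_cast ArithmeticFunction.abs_moebius_le_one
        rw [norm_mul, Complex.norm_intCast]
        split_ifs
        · rw [Complex.norm_natCast]
          exact mul_le_of_le_one_left (by positivity) hμ
        · simp
    _ = ∑ d ∈ q.divisors, if (d : ℤ) ∣ n then (d : ℝ) else 0 :=
        Nat.sum_divisorsAntidiagonal' (f := fun _ d ↦ if (d : ℤ) ∣ n then (d : ℝ) else 0)
    _ = ∑ d ∈ q.divisors.filter fun d : ℕ ↦ (d : ℤ) ∣ n, (d : ℝ) := (Finset.sum_filter _ _).symm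
    _ ≤ _ := by
        refine Finset.sum_le_sum_of_subset_of_nonneg (fun d hd ↦ ?_) fun _ _ _ ↦ by positivity
        rw [Finset.mem_filter] at hd
        exact Nat.mem_divisors.mpr ⟨Int.natCast_dvd.mp hd.2, Int.natAbs_ne_zero.mpr hn⟩

theorem card_filter_coprime_Icc (q : ℕ) :
    ((Finset.Icc 1 q).filter fun b ↦ Nat.Coprime b q).card = q.totient := by
  have h := Nat.filter_coprime_Ico_eq_totient q 1
  rw [← h]
  congr 1
  ext b
  simp only [Finset.mem_filter, Finset.mem_Icc, Finset.mem_Ico, Nat.coprime_comm (n := b)]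
  lia

/-- The average of `F` over the reduced fractions of denominator `q`. -/
noncomputable def coprimeAverage (F : ℝ → ℂ) (q : ℕ) : ℂ :=
  (q.totient : ℂ)⁻¹ * ∑ b ∈ (Finset.Icc 1 q).filter fun b ↦ Nat.Coprime b q, F ((b : ℝ) / q)

theorem norm_coprimeAverage_le {F : ℝ → ℂ} {ε : ℝ} (hε : 0 ≤ ε) (h : ∀ x, ‖F x‖ ≤ ε) (q : ℕ) :
    ‖coprimeAverage F q‖ ≤ ε := by
  rcases Nat.eq_zero_or_pos q with rfl | hq
  · simpa [coprimeAverage] using hε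
  have hφ : (0 : ℝ) < q.totient := by exact_mod_cast Nat.totient_pos.mpr hq
  rw [coprimeAverage, norm_mul, norm_inv, Complex.norm_natCast, inv_mul_le_iff₀ hφ,
    ← card_filter_coprime_Icc q]
  exact (norm_sum_le _ _).trans (by simpa using Finset.sum_le_card_nsmul _ _ ε fun b _ ↦ h _)

theorem integral_exp_two_pi_I_mul (j : ℤ) :
    ∫ x in (0 : ℝ)..1, Complex.exp (2 * Real.pi * Complex.I * j * x) = if j = 0 then 1 else 0 := by
  split_ifs with hj
  · simp [hj]
  · have hc : (2 * Real.pi * Complex.I * j : ℂ) ≠ 0 :=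
      mul_ne_zero Complex.two_pi_I_ne_zero (by exact_mod_cast hj)
    rw [integral_exp_mul_complex hc]
    have : Complex.exp (2 * Real.pi * Complex.I * j) = 1 :=
      Complex.exp_eq_one_iff.mpr ⟨j, by ring⟩
    simp [this]

theorem tendsto_coprimeAverage_fourier (n : ℤ) :
    Tendsto (coprimeAverage fun x : ℝ ↦ (fourier n (x : AddCircle (1 : ℝ)) : ℂ)) atTop
      (𝓝 (∫ x in (0 : ℝ)..1, (fourier n (x : AddCircle (1 : ℝ)) : ℂ))) := by
  simp only [fourier_coe_apply, Complex.ofReal_one, div_one]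
  rcases eq_or_ne n 0 with rfl | hn
  · refine tendsto_const_nhds.congr' ?_
    filter_upwards [eventually_gt_atTop 0] with q hq
    have hφ : (q.totient : ℂ) ≠ 0 := by exact_mod_cast (Nat.totient_pos.mpr hq).ne'
    simp [coprimeAverage, card_filter_coprime_Icc q, hφ]
  · rw [integral_exp_two_pi_I_mul, if_neg hn]
    have hφ : Tendsto (fun q : ℕ ↦ ((q.totient : ℝ))⁻¹ * ∑ d ∈ n.natAbs.divisors, (d : ℝ)) atTop
        (𝓝 0) := by
      simpa using (tendsto_inv_atTop_zero.comp
        (tendsto_natCast_atTop_atTop.comp tendsto_totient_atTop)).mul_const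
        (∑ d ∈ n.natAbs.divisors, (d : ℝ))
    refine squeeze_zero_norm' ?_ hφ
    filter_upwards [eventually_gt_atTop 0] with q hq
    rw [coprimeAverage, norm_mul, norm_inv, Complex.norm_natCast]
    gcongr
    exact norm_sum_exp_coprime_le hn hq

theorem tendsto_coprimeAverage_addCircle (F : C(AddCircle (1 : ℝ), ℂ)) :
    Tendsto (coprimeAverage fun x : ℝ ↦ F x) atTop (𝓝 (∫ x in (0 : ℝ)..1, F x)) := by
  have hcoe : Continuous ((↑) : ℝ → AddCircle (1 : ℝ)) := AddCircle.continuous_mk' 1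
  have hFint (G : C(AddCircle (1 : ℝ), ℂ)) :
      IntervalIntegrable (fun x : ℝ ↦ G (x : AddCircle (1 : ℝ))) volume 0 1 :=
    (G.continuous.comp hcoe).intervalIntegrable _ _
  have hspan (G : C(AddCircle (1 : ℝ), ℂ))
      (hG : G ∈ Submodule.span ℂ (Set.range (@fourier (1 : ℝ)))) :
      Tendsto (coprimeAverage fun x : ℝ ↦ G x) atTop (𝓝 (∫ x in (0 : ℝ)..1, G x)) := by
    induction hG using Submodule.span_induction with
    | mem G h =>
      obtain ⟨n, rfl⟩ := h
      exact tendsto_coprimeAverage_fourier n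
    | zero =>
      have h0 : (coprimeAverage fun _ : ℝ ↦ (0 : ℂ)) = fun _ ↦ 0 := by
        ext q
        simp [coprimeAverage]
      simp only [ContinuousMap.zero_apply, h0, intervalIntegral.integral_zero, tendsto_const_nhds]
    | add G H _ _ hG hH =>
      simp only [ContinuousMap.add_apply]
      rw [intervalIntegral.integral_add (hFint G) (hFint H)]
      refine (hG.add hH).congr fun q ↦ ?_
      simp [coprimeAverage, Finset.sum_add_distrib, mul_add]
    | smul c G _ hG =>
      simp only [ContinuousMap.smul_apply]
      rw [intervalIntegral.integral_smul]
      refine (hG.const_smul c).congr fun q ↦ ?_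
      simp [coprimeAverage, Finset.mul_sum, mul_left_comm]
  rw [Metric.tendsto_atTop]
  intro ε hε
  have hF : F ∈ closure (Submodule.span ℂ (Set.range (@fourier (1 : ℝ))) : Set C(AddCircle (1 : ℝ), ℂ)) := by
    rw [← Submodule.topologicalClosure_coe, span_fourier_closure_eq_top]
    trivial
  obtain ⟨G, hG, hFG⟩ := Metric.mem_closure_iff.mp hF (ε / 4) (by positivity)
  have hpt (x : ℝ) : ‖F x - G x‖ ≤ ε / 4 := by
    rw [← dist_eq_norm]
    exact (ContinuousMap.dist_apply_le_dist _).trans hFG.le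
  obtain ⟨Q, hQ⟩ := Metric.tendsto_atTop.mp (hspan G hG) (ε / 4) (by positivity)
  refine ⟨Q, fun q hq ↦ ?_⟩
  have h1 : ‖coprimeAverage (fun x : ℝ ↦ F x) q - coprimeAverage (fun x : ℝ ↦ G x) q‖ ≤ ε / 4 := by
    have := norm_coprimeAverage_le (by positivity) hpt q
    simpa only [coprimeAverage, Finset.sum_sub_distrib, mul_sub] using this
  have h2 : ‖(∫ x in (0 : ℝ)..1, F x) - ∫ x in (0 : ℝ)..1, G x‖ ≤ ε / 4 := by
    rw [← intervalIntegral.integral_sub (hFint F) (hFint G)]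
    simpa using intervalIntegral.norm_integral_le_of_norm_le_const
      (a := 0) (b := 1) (f := fun x : ℝ ↦ F x - G x) fun x _ ↦ hpt x
  have h3 := hQ q hq
  rw [dist_eq_norm] at h3 ⊢
  calc _ = ‖(coprimeAverage (fun x : ℝ ↦ F x) q - coprimeAverage (fun x : ℝ ↦ G x) q) +
        (coprimeAverage (fun x : ℝ ↦ G x) q - ∫ x in (0 : ℝ)..1, G x) -
        ((∫ x in (0 : ℝ)..1, F x) - ∫ x in (0 : ℝ)..1, G x)‖ := by congr 1; ring
    _ ≤ ε / 4 + ε / 4 + ε / 4 :=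
        (norm_sub_le _ _).trans (add_le_add ((norm_add_le _ _).trans (add_le_add h1 h3.le)) h2)
    _ < ε := by linarith

/-- Reduced fractions of denominator `q` equidistribute modulo one as `q → ∞`. -/
theorem tendsto_sum_coprime_div_totient {F : ℝ → ℝ} (hF : Continuous F)
    (hper : Function.Periodic F 1) :
    Tendsto (fun q : ℕ ↦ (∑ b ∈ (Finset.Icc 1 q).filter fun b ↦ Nat.Coprime b q,
      F ((b : ℝ) / q)) / (q.totient : ℝ)) atTop (𝓝 (∫ x in Icc (0 : ℝ) 1, F x)) := by
  have hper' : Function.Periodic (fun x ↦ (F x : ℂ)) 1 := fun x ↦ by simp only [hper x]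
  let G : C(AddCircle (1 : ℝ), ℂ) :=
    ⟨hper'.lift, continuous_coinduced_dom.mpr (Complex.continuous_ofReal.comp hF)⟩
  have hG (x : ℝ) : G (x : AddCircle (1 : ℝ)) = F x := hper'.lift_coe x
  have h := tendsto_coprimeAverage_addCircle G
  simp only [hG, intervalIntegral.integral_ofReal] at h
  have h' := (Complex.continuous_re.tendsto _).comp h
  rw [Complex.ofReal_re, intervalIntegral.integral_of_le zero_le_one,
    ← integral_Icc_eq_integral_Ioc] at h'
  refine h'.congr fun q ↦ ?_
  rw [Function.comp_apply, coprimeAverage, ← Complex.ofReal_natCast, ← Complex.ofReal_inv,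
    ← Complex.ofReal_sum, ← Complex.ofReal_mul, Complex.ofReal_re, div_eq_inv_mul]

theorem Real.volume_le_mul_image_of_dist_le {f : ℝ → ℝ} {s : Set ℝ} {K : NNReal}
    (h : ∀ x ∈ s, ∀ y ∈ s, dist x y ≤ K * dist (f x) (f y)) :
    volume s ≤ K * volume (f '' s) := by
  have ha : AntilipschitzWith K (s.domRestrict f) :=
    AntilipschitzWith.of_le_mul_dist fun x y ↦ h x x.2 y y.2
  have := ha.le_hausdorffMeasure_image (zero_le_one (α := ℝ)) univ
  rwa [← (isometry_subtype_coe (s := s)).hausdorffMeasure_image (Or.inl zero_le_one), image_univ,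
    Subtype.range_coe, image_univ, range_domRestrict, hausdorffMeasure_real, ENNReal.rpow_one] at this

theorem exists_irrational_density_point {E : Set ℝ} (hE : MeasurableSet E) (h0 : volume E ≠ 0) :
    ∃ x : ℝ, Irrational x ∧ ∀ ε > 0, ∃ r₀ > 0, ∀ r, 0 < r → r < r₀ →
      volume (Metric.closedBall x r \ E) ≤ ENNReal.ofReal (ε * (2 * r)) := by
  have hirr : ∀ᵐ x : ℝ, Irrational x :=
    (countable_range _).ae_notMem volume
  have hfreq : ∃ᵐ x : ℝ, x ∈ E := by
    rwa [frequently_ae_iff]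
  obtain ⟨x, hxE, hx, hlim⟩ := (hfreq.and_eventually (hirr.and
    (Besicovitch.ae_tendsto_measure_inter_div_of_measurableSet volume hE.compl))).exists
  rw [indicator_of_notMem (by simpa using hxE)] at hlim
  refine ⟨x, hx, fun ε hε ↦ ?_⟩
  have hev := hlim.eventually_le_const (u := ENNReal.ofReal ε) (by simpa using hε)
  obtain ⟨r₀, hr₀, h⟩ := (mem_nhdsGT_iff_exists_Ioo_subset).mp hev
  refine ⟨r₀, hr₀, fun r hr hr' ↦ ?_⟩
  have := h ⟨hr, hr'⟩
  rw [mem_ofPred_eq, Real.volume_closedBall, ENNReal.div_le_iff (by simpa using hr) ENNReal.ofReal_ne_top,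
    ← ENNReal.ofReal_mul hε.le, inter_comm] at this
  exact this

theorem exists_close_coprime_fraction {x : ℝ} (hx : Irrational x) (N : ℕ) :
    ∃ (p : ℤ) (q : ℕ), N < q ∧ IsCoprime p q ∧ |x - p / q| < 1 / (q : ℝ) ^ 2 := by
  have hfin : {r : ℚ | r.den ≤ N ∧ |x - r| ≤ 1}.Finite := by
    let M : ℤ := ⌈(|x| + 1) * N⌉
    refine (((finite_Icc (-M) M).prod (finite_Iic N)).image
      fun t : ℤ × ℕ ↦ (t.1 : ℚ) / t.2).subset fun r ⟨hr, hxr⟩ ↦ ?_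
    refine ⟨(r.num, r.den), ⟨abs_le.mp ?_, hr⟩, r.num_div_den⟩
    have hd : (0 : ℝ) < r.den := by exact_mod_cast r.den_pos
    have hnum : (r.num : ℝ) = r * r.den := by exact_mod_cast (Rat.mul_den_eq_num r).symm
    have hr' : (r.den : ℝ) ≤ N := by exact_mod_cast hr
    have hxr' : |(r : ℝ)| ≤ |x| + 1 := by
      have := abs_sub_abs_le_abs_sub (r : ℝ) x
      rw [abs_sub_comm] at this
      linarith
    have : |(r.num : ℝ)| ≤ (|x| + 1) * N := by
      rw [hnum, abs_mul, abs_of_pos hd]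
      gcongr
    exact_mod_cast this.trans (Int.le_ceil _)
  obtain ⟨r, hr, hrN⟩ := ((Real.infinite_rat_abs_sub_lt_one_div_den_sq_of_irrational hx).sdiff
    hfin).nonempty
  have hden : (1 : ℝ) ≤ r.den := by exact_mod_cast r.den_pos
  have hr1 : |x - r| ≤ 1 := by
    refine (le_of_lt hr).trans ?_
    rw [div_le_one (by positivity)]
    exact one_le_pow₀ hden
  refine ⟨r.num, r.den, ?_, Int.isCoprime_iff_nat_coprime.mpr r.reduced, ?_⟩
  · by_contra! h
    exact hrN ⟨h, hr1⟩
  · have : (r.num : ℝ) / r.den = r := by exact_mod_cast r.num_div_den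
    rw [this]
    exact hr

theorem exists_specialLinearGroup_of_isCoprime {p : ℤ} {q : ℕ} (hq : 0 < q) (h : IsCoprime p q) :
    ∃ γ : Matrix.SpecialLinearGroup (Fin 2) ℤ, γ 0 0 = p ∧ γ 1 0 = q ∧ q ≤ γ 1 1 ∧ γ 1 1 < 2 * q := by
  obtain ⟨u, v, huv⟩ := h
  let s := u % q + q
  have hq' : (0 : ℤ) < q := by exact_mod_cast hq
  have hs : s = u + q * (1 - u / q) := by
    have := Int.emod_add_mul_ediv u q
    simp only [s]
    linear_combination this
  have hdet : p * s - (p * (1 - u / q) - v) * q = 1 := by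
    rw [hs]
    linear_combination huv
  refine ⟨⟨!![p, p * (1 - u / q) - v; q, s], by rw [Matrix.det_fin_two_of, hdet]⟩, rfl, rfl, ?_, ?_⟩
  · have := Int.emod_nonneg u hq'.ne'
    change (q : ℤ) ≤ s
    lia
  · have := Int.emod_lt_of_pos u hq'
    change s < 2 * q
    lia

theorem exists_specialLinearGroup_volume_le {E : Set ℝ} (hE : MeasurableSet E) (h0 : volume E ≠ 0)
    {ε : ℝ} (hε : 0 < ε) : ∃ γ : Matrix.SpecialLinearGroup (Fin 2) ℤ,
      (∀ y ∈ Icc (0 : ℝ) 2, (γ 1 0 : ℝ) * y + γ 1 1 ≠ 0) ∧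
      volume {y ∈ Icc (0 : ℝ) 2 | ((γ 0 0 : ℝ) * y + γ 0 1) / ((γ 1 0 : ℝ) * y + γ 1 1) ∉ E} ≤
        ENNReal.ofReal ε := by
  obtain ⟨x, hx, hdens⟩ := exists_irrational_density_point hE h0
  obtain ⟨r₀, hr₀, hdens⟩ := hdens (ε / 64) (by positivity)
  obtain ⟨N, hN⟩ := exists_nat_gt (2 / r₀)
  obtain ⟨p, q, hNq, hpq, hxpq⟩ := exists_close_coprime_fraction hx N
  have hq : 0 < q := by lia
  obtain ⟨γ, h00, h10, hle, hlt⟩ := exists_specialLinearGroup_of_isCoprime hq hpq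
  have hdet : (p : ℝ) * γ 1 1 - γ 0 1 * q = 1 := by
    have := γ.det_coe
    rw [Matrix.det_fin_two, h00, h10] at this
    exact_mod_cast this
  refine ⟨γ, ?_⟩
  simp only [h00, h10, Int.cast_natCast]
  generalize γ 1 1 = s at hle hlt hdet ⊢
  have hq1 : (1 : ℝ) ≤ q := by exact_mod_cast hq
  have hq0 : (q : ℝ) ≠ 0 := by positivity
  have hle' : (q : ℝ) ≤ s := by exact_mod_cast hle
  have hlt' : (s : ℝ) ≤ 2 * q := by exact_mod_cast hlt.le
  have hlow (y : ℝ) (hy : y ∈ Icc (0 : ℝ) 2) : (q : ℝ) ≤ q * y + s := by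
    have := mul_nonneg (by positivity : (0 : ℝ) ≤ q) hy.1
    linarith
  have hupp (y : ℝ) (hy : y ∈ Icc (0 : ℝ) 2) : (q : ℝ) * y + s ≤ 4 * q := by
    have := mul_le_mul_of_nonneg_left hy.2 (by positivity : (0 : ℝ) ≤ q)
    linarith
  have hne (y : ℝ) (hy : y ∈ Icc (0 : ℝ) 2) : (q : ℝ) * y + s ≠ 0 := by
    have := hlow y hy
    linarith
  have hmob (y : ℝ) (hy : y ∈ Icc (0 : ℝ) 2) :
      ((p : ℝ) * y + γ 0 1) / (q * y + s) = p / q - 1 / (q * (q * y + s)) := by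
    have ht := hne y hy
    rw [div_sub_div _ _ hq0 (mul_ne_zero hq0 ht), div_eq_div_iff ht (by simp [hq0, ht])]
    linear_combination (-(q * (q * y + s))) * hdet
  refine ⟨hne, ?_⟩
  have hball (y : ℝ) (hy : y ∈ Icc (0 : ℝ) 2) :
      ((p : ℝ) * y + γ 0 1) / (q * y + s) ∈ Metric.closedBall x (2 / (q : ℝ) ^ 2) := by
    have h1 : 1 / ((q : ℝ) * (q * y + s)) ≤ 1 / (q : ℝ) ^ 2 := by
      rw [sq]
      gcongr
      exact hlow y hy
    have h2 : 0 ≤ 1 / ((q : ℝ) * (q * y + s)) := by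
      have := hlow y hy
      exact div_nonneg zero_le_one (mul_nonneg (by positivity) (by linarith))
    have h3 : 2 / (q : ℝ) ^ 2 = 1 / (q : ℝ) ^ 2 + 1 / (q : ℝ) ^ 2 := by ring
    rw [abs_lt] at hxpq
    rw [hmob y hy, Metric.mem_closedBall, Real.dist_eq, abs_le, h3]
    constructor <;> linarith
  have hanti (y : ℝ) (hy : y ∈ Icc (0 : ℝ) 2) (z : ℝ) (hz : z ∈ Icc (0 : ℝ) 2) :
      dist y z ≤ (16 * (q : ℝ) ^ 2) * dist (((p : ℝ) * y + γ 0 1) / (q * y + s))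
        (((p : ℝ) * z + γ 0 1) / (q * z + s)) := by
    have hy' := hlow y hy
    have hz' := hlow z hz
    have : ((p : ℝ) * y + γ 0 1) / (q * y + s) - ((p : ℝ) * z + γ 0 1) / (q * z + s) =
        (y - z) / ((q * y + s) * (q * z + s)) := by
      rw [div_sub_div _ _ (hne y hy) (hne z hz)]
      congr 1
      linear_combination (y - z) * hdet
    have hprod : ((q : ℝ) * y + s) * (q * z + s) ≤ 16 * (q : ℝ) ^ 2 := by
      calc ((q : ℝ) * y + s) * (q * z + s) ≤ (4 * q) * (4 * q) :=
            mul_le_mul (hupp y hy) (hupp z hz) (by linarith) (by positivity)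
        _ = _ := by ring
    have hpos : 0 < ((q : ℝ) * y + s) * (q * z + s) := mul_pos (by linarith) (by linarith)
    rw [Real.dist_eq, Real.dist_eq, this, abs_div, abs_of_pos hpos, ← mul_div_assoc,
      le_div_iff₀ hpos, mul_comm]
    gcongr
  have hr : 2 / (q : ℝ) ^ 2 < r₀ := by
    have hNq' : (N : ℝ) ≤ q := by exact_mod_cast hNq.le
    rw [div_lt_iff₀ hr₀] at hN
    rw [div_lt_iff₀ (by positivity)]
    calc 2 < N * r₀ := hN
      _ ≤ q ^ 2 * r₀ := by
        gcongr
        nlinarith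
      _ = _ := mul_comm _ _
  let K : NNReal := 16 * (q : NNReal) ^ 2
  calc volume {y ∈ Icc (0 : ℝ) 2 | ((p : ℝ) * y + γ 0 1) / (q * y + s) ∉ E}
      ≤ K * volume ((fun y ↦ ((p : ℝ) * y + γ 0 1) / (q * y + s)) ''
          {y ∈ Icc (0 : ℝ) 2 | ((p : ℝ) * y + γ 0 1) / (q * y + s) ∉ E}) :=
        Real.volume_le_mul_image_of_dist_le fun y hy z hz ↦ by
          simpa [K] using hanti y hy.1 z hz.1
    _ ≤ K * volume (Metric.closedBall x (2 / (q : ℝ) ^ 2) \ E) := by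
        gcongr
        rintro _ ⟨y, ⟨hy, hyE⟩, rfl⟩
        exact ⟨hball y hy, hyE⟩
    _ ≤ K * ENNReal.ofReal (ε / 64 * (2 * (2 / (q : ℝ) ^ 2))) := by
        gcongr
        exact hdens _ (by positivity) hr
    _ = ENNReal.ofReal ε := by
        rw [← ENNReal.ofReal_coe_nnreal, ← ENNReal.ofReal_mul (NNReal.coe_nonneg _)]
        congr 1
        simp only [K]
        push_cast
        field_simp
        norm_num

theorem Polynomial.eval_eq_eval_zero_of_infinite_periodic {R : Type*} [CommRing R] [IsDomain R]
    [CharZero R] {Q : Polynomial R} (h : {y | Q.eval (y + 1) = Q.eval y}.Infinite) (y : R) :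
    Q.eval y = Q.eval 0 := by
  have hcomp : Q.comp (X + 1) = Q := Polynomial.eq_of_infinite_eval_eq _ _ (by simpa using h)
  have hstep (y : R) : Q.eval (y + 1) = Q.eval y := by
    conv_rhs => rw [← hcomp]
    simp
  have hnat (n : ℕ) : Q.eval (n : R) = Q.eval 0 := by
    induction n with
    | zero => simp
    | succ n ih => rw [Nat.cast_succ, hstep, ih]
  have hQ : Q = Polynomial.C (Q.eval 0) := Polynomial.eq_of_infinite_eval_eq _ _
    ((infinite_range_of_injective (Nat.cast_injective (R := R))).mono (by
      rintro _ ⟨n, rfl⟩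
      simp [hnat]))
  rw [hQ]
  simp

theorem exists_eq_const_of_volume_ne_polynomial_le {h : ℝ → ℝ} (hper : Function.Periodic h 1)
    {Q : Polynomial ℝ} {δ : ℝ} (hδ : δ < 1 / 2)
    (hQ : volume {y ∈ Icc (0 : ℝ) 2 | h y ≠ Q.eval y} ≤ ENNReal.ofReal δ) :
    ∃ κ : ℝ, ∀ y, Q.eval y = κ := by
  set B := {y ∈ Icc (0 : ℝ) 2 | h y ≠ Q.eval y}
  refine ⟨Q.eval 0, Polynomial.eval_eq_eval_zero_of_infinite_periodic fun hfin ↦ ?_⟩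
  have hcover : Icc (0 : ℝ) 1 ⊆ {y | Q.eval (y + 1) = Q.eval y} ∪ (B ∪ (fun y ↦ y + 1) ⁻¹' B) := by
    intro y hy
    by_contra! hcon
    simp only [B, mem_union, mem_ofPred_eq, mem_preimage, not_or, not_and, not_not] at hcon
    obtain ⟨h1, h2, h3⟩ := hcon
    rw [← h2 ⟨hy.1, by linarith [hy.2]⟩, ← h3 ⟨by linarith [hy.1], by linarith [hy.2]⟩, hper] at h1
    exact h1 rfl
  have hvol : volume (Icc (0 : ℝ) 1) ≤ 0 + (ENNReal.ofReal δ + ENNReal.ofReal δ) := by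
    refine (measure_mono hcover).trans ((measure_union_le _ _).trans ?_)
    rw [hfin.measure_zero]
    gcongr
    refine (measure_union_le _ _).trans ?_
    rw [measure_preimage_add_right]
    gcongr
  rw [Real.volume_Icc, zero_add, ← two_mul, sub_zero, ← ENNReal.ofReal_ofNat,
    ← ENNReal.ofReal_mul zero_le_two, ENNReal.ofReal_le_ofReal_iff'] at hvol
  norm_num at hvol
  linarith

/-- A continuous periodic function that is approximated by polynomials in measure is constant. -/
theorem eq_of_forall_exists_volume_ne_polynomial_le {h : ℝ → ℝ} (hcont : Continuous h)
    (hper : Function.Periodic h 1)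
    (happ : ∀ δ > 0, ∃ Q : Polynomial ℝ,
      volume {y ∈ Icc (0 : ℝ) 2 | h y ≠ Q.eval y} ≤ ENNReal.ofReal δ) (x y : ℝ) :
    h x = h y := by
  obtain ⟨x', hx', hxx⟩ := hper.exists_mem_Ioc one_pos x 0
  obtain ⟨y', hy', hyy⟩ := hper.exists_mem_Ioc one_pos y 0
  rw [hxx, hyy]
  by_contra hne
  obtain ⟨U, V, hU, hV, hxU, hyV, hUV⟩ := t2_separation hne
  have hpos (W : Set ℝ) (hW : IsOpen W) (z : ℝ) (hz : z ∈ Ioc (0 : ℝ) (0 + 1)) (hzW : h z ∈ W) :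
      0 < volume (Ioo (0 : ℝ) 2 ∩ h ⁻¹' W) :=
    (isOpen_Ioo.inter (hW.preimage hcont)).measure_pos _ ⟨z, ⟨hz.1, by linarith [hz.2]⟩, hzW⟩
  obtain ⟨δ, hδ, hδU, hδV, hδ2⟩ : ∃ δ > 0, ENNReal.ofReal δ < volume (Ioo (0 : ℝ) 2 ∩ h ⁻¹' U) ∧
      ENNReal.ofReal δ < volume (Ioo (0 : ℝ) 2 ∩ h ⁻¹' V) ∧ δ < 1 / 2 := by
    have hlim : Tendsto ENNReal.ofReal (𝓝[>] 0) (𝓝 0) := by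
      simpa using (ENNReal.continuous_ofReal.tendsto 0).mono_left nhdsWithin_le_nhds
    have h2 : ∀ᶠ δ : ℝ in 𝓝[>] 0, δ < 1 / 2 :=
      nhdsWithin_le_nhds (Iio_mem_nhds (by norm_num))
    have h1 : ∀ᶠ δ : ℝ in 𝓝[>] 0, 0 < δ := self_mem_nhdsWithin
    obtain ⟨δ, h1, h2, h3, h4⟩ := (h1.and ((hlim.eventually_lt_const
      (hpos U hU x' hx' hxU)).and ((hlim.eventually_lt_const (hpos V hV y' hy' hyV)).and h2))).exists
    exact ⟨δ, h1, h2, h3, h4⟩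
  obtain ⟨Q, hQ⟩ := happ δ hδ
  obtain ⟨κ, hκ⟩ := exists_eq_const_of_volume_ne_polynomial_le hper hδ2 hQ
  have hmem (W : Set ℝ) (hW : ENNReal.ofReal δ < volume (Ioo (0 : ℝ) 2 ∩ h ⁻¹' W)) : κ ∈ W := by
    by_contra hκW
    refine (hW.trans_le (measure_mono ?_)).not_ge hQ
    rintro z ⟨hz, hzW⟩
    refine ⟨Ioo_subset_Icc_self hz, fun heq ↦ hκW ?_⟩
    rwa [← hκ z, ← heq]
  exact hUV.ne_of_mem (hmem U hδU) (hmem V hδV) rfl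

theorem continuous_qSeries_ofReal {b : ℕ → ℂ} (hb : Summable fun n ↦ ‖b n‖) :
    Continuous fun x : ℝ ↦ qSeries b x :=
  (continuousOn_qSeries hb).comp_continuous Complex.continuous_ofReal fun x ↦ by simp

theorem qSeries_add_one (b : ℕ → ℂ) (z : ℂ) : qSeries b (z + 1) = qSeries b z := by
  refine tsum_congr fun n ↦ ?_
  have : Complex.exp (2 * Real.pi * Complex.I * n) = 1 :=
    Complex.exp_eq_one_iff.mpr ⟨n, by push_cast; ring⟩
  rw [mul_add, mul_one, Complex.exp_add, this, mul_one]

theorem integral_exp_mul_qSeries {b : ℕ → ℂ} (hb : Summable fun n ↦ ‖b n‖) (j : ℤ) :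
    ∫ x in (0 : ℝ)..1, Complex.exp (2 * Real.pi * Complex.I * j * x) * qSeries b x =
      ∑' n : ℕ, if (j + n : ℤ) = 0 then b n else 0 := by
  have hnorm (n : ℤ) (x : ℝ) : ‖Complex.exp (2 * Real.pi * Complex.I * n * x)‖ = 1 := by
    rw [Complex.norm_exp]
    simp
  let f (n : ℕ) : C(ℝ, ℂ) :=
    ⟨fun x ↦ b n * Complex.exp (2 * Real.pi * Complex.I * (j + n : ℤ) * x), by fun_prop⟩
  have hf : Summable fun n ↦
      ‖(f n).restrict (⟨uIcc (0 : ℝ) 1, isCompact_uIcc⟩ : TopologicalSpace.Compacts ℝ)‖ := by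
    refine Summable.of_nonneg_of_le (fun n ↦ norm_nonneg _) (fun n ↦ ?_) hb
    refine (ContinuousMap.norm_le _ (norm_nonneg _)).mpr fun x ↦ ?_
    simp only [f, ContinuousMap.restrict_apply, ContinuousMap.coe_mk, norm_mul, hnorm, mul_one]
    exact le_rfl
  refine Eq.trans ?_ ((intervalIntegral.hasSum_intervalIntegral_of_summable_norm hf).tsum_eq.symm.trans
    ?_)
  rotate_left
  · refine tsum_congr fun n ↦ ?_
    simp only [f, ContinuousMap.coe_mk, intervalIntegral.integral_const_mul,
      integral_exp_two_pi_I_mul, mul_ite, mul_one, mul_zero]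
  · congr 1
    ext x
    rw [qSeries, ← tsum_mul_left]
    refine tsum_congr fun n ↦ ?_
    simp only [f, ContinuousMap.coe_mk]
    rw [mul_left_comm, ← Complex.exp_add]
    push_cast
    ring_nf

/-- If a nonzero real linear form of `Σ b n e(nx)` is constant, then `b` vanishes outside `0`. -/
theorem eq_zero_of_linearMap_qSeries_const {b : ℕ → ℂ} (hb : Summable fun n ↦ ‖b n‖)
    {φ : ℂ →ₗ[ℝ] ℝ} (hφ : φ ≠ 0) (hconst : ∀ x y : ℝ, φ (qSeries b x) = φ (qSeries b y))
    {m : ℕ} (hm : m ≠ 0) : b m = 0 := by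
  set A : ℂ := ⟨φ 1, -φ Complex.I⟩
  have hφA (z : ℂ) : 2 * (φ z : ℂ) = A * z + (starRingEnd ℂ) (A * z) := by
    have hz : φ z = z.re * φ 1 + z.im * φ Complex.I := by
      have : z = z.re • (1 : ℂ) + z.im • Complex.I := by simp
      conv_lhs => rw [this, map_add, map_smul, map_smul, smul_eq_mul, smul_eq_mul]
    rw [Complex.add_conj, hz, Complex.mul_re, show A.re = φ 1 from rfl,
      show A.im = -φ Complex.I from rfl]
    push_cast
    ring
  have hA : A ≠ 0 := by
    intro hA
    apply hφ
    ext z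
    have := hφA z
    simpa [hA] using this
  set E : ℝ → ℂ := fun x ↦ Complex.exp (2 * Real.pi * Complex.I * (-m : ℤ) * x)
  have hEc : Continuous E := by fun_prop
  have hqc := continuous_qSeries_ofReal hb
  have hI1 : ∫ x in (0 : ℝ)..1, E x * qSeries b x = b m := by
    rw [integral_exp_mul_qSeries hb, tsum_eq_single m]
    · simp
    · intro n hn
      rw [if_neg (by lia)]
  have hI2 : ∫ x in (0 : ℝ)..1, E x * (starRingEnd ℂ) (qSeries b x) = 0 := by
    have hE (x : ℝ) : E x = (starRingEnd ℂ) (Complex.exp (2 * Real.pi * Complex.I * (m : ℤ) * x)) := by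
      rw [← Complex.exp_conj]
      simp [E, Complex.conj_ofNat]
    simp_rw [hE, ← map_mul]
    rw [intervalIntegral.integral_of_le zero_le_one, integral_conj,
      ← intervalIntegral.integral_of_le zero_le_one, integral_exp_mul_qSeries hb]
    have (n : ℕ) : ¬ ((m : ℤ) + n = 0) := by lia
    simp [this]
  have hI3 : ∫ x in (0 : ℝ)..1, E x * (2 * (φ (qSeries b x) : ℂ)) = 0 := by
    simp_rw [fun x : ℝ ↦ hconst x 0]
    rw [intervalIntegral.integral_mul_const, integral_exp_two_pi_I_mul, if_neg (by lia), zero_mul]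
  have hsplit : ∫ x in (0 : ℝ)..1, E x * (2 * (φ (qSeries b x) : ℂ)) = A * b m := by
    have (x : ℝ) : E x * (2 * (φ (qSeries b x) : ℂ)) =
        A * (E x * qSeries b x) + (starRingEnd ℂ) A * (E x * (starRingEnd ℂ) (qSeries b x)) := by
      rw [hφA, map_mul]
      ring
    simp_rw [this]
    rw [intervalIntegral.integral_add (Continuous.intervalIntegrable (by fun_prop) _ _)
      (Continuous.intervalIntegrable (by fun_prop) _ _), intervalIntegral.integral_const_mul,
      intervalIntegral.integral_const_mul, hI1, hI2, mul_zero, add_zero]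
  rw [hI3] at hsplit
  exact (mul_eq_zero.mp hsplit.symm).resolve_left hA

theorem Polynomial.exists_eval_eq_linearMap_eval (φ : ℂ →ₗ[ℝ] ℝ) (P : Polynomial ℂ) :
    ∃ Q : Polynomial ℝ, ∀ y : ℝ, Q.eval y = φ (P.eval (y : ℂ)) := by
  refine ⟨∑ i ∈ Finset.range (P.natDegree + 1), Polynomial.monomial i (φ (P.coeff i)), fun y ↦ ?_⟩
  rw [Polynomial.eval_finsetSum, Polynomial.eval_eq_sum_range, map_sum]
  refine Finset.sum_congr rfl fun i _ ↦ ?_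
  have : P.coeff i * (y : ℂ) ^ i = (y ^ i : ℝ) • P.coeff i := by
    rw [Complex.real_smul, mul_comm]
    push_cast
    rfl
  rw [this, map_smul, Polynomial.eval_monomial, smul_eq_mul, mul_comm]

/-- If a real linear form of the Eichler integral takes some value on a set of positive measure,
then it is constant. -/
theorem linearMap_qSeries_const_of_volume_ne_zero {n : ℕ} {k : ℤ} (hkn : k = n + 2)
    (g : CuspForm (⊤ : Subgroup (Matrix.SpecialLinearGroup (Fin 2) ℤ)) k)
    {b : ℕ → ℂ} (hb : Summable fun m ↦ ‖b m‖)
    (hexp : ∀ z : UpperHalfPlane, g z = qSeries (fun m ↦ (m : ℂ) ^ (n + 1) * b m) z)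
    (φ : ℂ →ₗ[ℝ] ℝ) {c : ℝ} (h0 : volume {x : ℝ | φ (qSeries b x) = c} ≠ 0) (x y : ℝ) :
    φ (qSeries b x) = φ (qSeries b y) := by
  have hφ : Continuous φ := φ.continuous_of_finiteDimensional
  have hcont : Continuous fun x : ℝ ↦ φ (qSeries b x) := hφ.comp (continuous_qSeries_ofReal hb)
  have hper : Function.Periodic (fun x : ℝ ↦ φ (qSeries b x)) 1 := fun x ↦ by
    simp only [Complex.ofReal_add, Complex.ofReal_one, qSeries_add_one]
  refine eq_of_forall_exists_volume_ne_polynomial_le hcont hper (fun δ hδ ↦ ?_) x y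
  obtain ⟨γ, hne, hvol⟩ := exists_specialLinearGroup_volume_le
    (isClosed_eq hcont continuous_const).measurableSet h0 hδ
  obtain ⟨P, hP⟩ := exists_period_polynomial hkn g hb hexp γ
  obtain ⟨Q, hQ⟩ := P.exists_eval_eq_linearMap_eval φ
  refine ⟨Polynomial.C c * (Polynomial.C (γ 1 0 : ℝ) * Polynomial.X + Polynomial.C (γ 1 1 : ℝ)) ^ n
    - Q, le_trans (measure_mono ?_) hvol⟩
  rintro y ⟨hy, hyQ⟩
  refine ⟨hy, fun hyE ↦ hyQ ?_⟩
  have h := congrArg φ (hP y (hne y hy))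
  rw [← Complex.ofReal_pow, ← Complex.real_smul, map_smul, map_add, ← hQ, smul_eq_mul,
    mem_ofPred_eq.mp hyE] at h
  simp only [Polynomial.eval_sub, Polynomial.eval_mul, Polynomial.eval_C, Polynomial.eval_pow,
    Polynomial.eval_add, Polynomial.eval_X]
  linear_combination -h

/-- For a nonzero cusp form `g` of weight `k ≥ 12` and level `1` with
Fourier coefficients `a n`, the Eichler integral `g̃(x) = Σ_{n≥1} a_n n^{1-k} e^{2πinx}`
converges absolutely, its values at reduced fractions `a/q` equidistribute as `q → ∞`
according to the pushforward of Lebesgue measure under `g̃`, and for every nonzero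
`ℝ`-linear form `φ : ℂ → ℝ` the pushforward under `φ ∘ g̃` is diffuse. -/
theorem stmt18 (k : ℤ) (hk : 12 ≤ k)
    (g : CuspForm (⊤ : Subgroup (Matrix.SpecialLinearGroup (Fin 2) ℤ)) k) (hg : g ≠ 0)
    (a : ℕ → ℂ) (ha0 : a 0 = 0)
    (hexp : ∀ z : UpperHalfPlane,
      g z = ∑' n : ℕ, a n * Complex.exp (2 * Real.pi * Complex.I * n * (z : ℂ)))
    (gtil : ℝ → ℂ)
    (hgtil : ∀ x : ℝ, gtil x =
      ∑' n : ℕ, a n / (n : ℂ) ^ (k - 1) * Complex.exp (2 * Real.pi * Complex.I * n * x)) :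
    -- (a) absolute convergence
    (∀ x : ℝ, Summable fun n : ℕ =>
      ‖a n / (n : ℂ) ^ (k - 1) * Complex.exp (2 * Real.pi * Complex.I * n * x)‖) ∧
    -- (b) equidistribution of the values at reduced fractions
    (∀ G : ℂ → ℝ, Continuous G → (∃ M : ℝ, ∀ z : ℂ, |G z| ≤ M) →
      Tendsto (fun q : ℕ =>
          (∑ b ∈ (Finset.Icc 1 q).filter fun b => Nat.Coprime b q, G (gtil ((b : ℝ) / q)))
            / (q.totient : ℝ))
        atTop (nhds (∫ x in Set.Icc (0 : ℝ) 1, G (gtil x)))) ∧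
    -- (c) diffuseness
    (∀ φ : ℂ →ₗ[ℝ] ℝ, φ ≠ 0 → ∀ c : ℝ,
      volume {x ∈ Set.Icc (0 : ℝ) 1 | φ (gtil x) = c} = 0) := by
  set b : ℕ → ℂ := fun n ↦ a n / (n : ℂ) ^ (k - 1) with hb_def
  obtain ⟨C, hC⟩ := exists_norm_coeff_div_le hk (exists_norm_coeff_le hg ha0 hexp)
  have hb : Summable fun n ↦ ‖b n‖ := Summable.of_nonneg_of_le (fun n ↦ norm_nonneg _) hC
    ((Real.summable_one_div_nat_pow.mpr one_lt_two).mul_left C)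
  have hq (x : ℝ) : gtil x = qSeries b x := hgtil x
  obtain ⟨n, hn⟩ := Int.eq_ofNat_of_zero_le (show 0 ≤ k - 2 by lia)
  have hkn : k = n + 2 := by lia
  have hab (m : ℕ) : (m : ℂ) ^ (n + 1) * b m = a m := by
    rcases eq_or_ne m 0 with rfl | hm
    · simp [ha0]
    · have hm' : (m : ℂ) ≠ 0 := by exact_mod_cast hm
      have hpow : (m : ℂ) ^ (k - 1) = (m : ℂ) ^ (n + 1) := by
        rw [show k - 1 = ((n + 1 : ℕ) : ℤ) by push_cast; lia, zpow_natCast]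
      rw [hb_def]
      simp only [hpow]
      field_simp
  have hexp' (z : UpperHalfPlane) : g z = qSeries (fun m ↦ (m : ℂ) ^ (n + 1) * b m) z := by
    simp only [hab]
    exact hexp z
  refine ⟨fun x ↦ ?_, fun G hG _ ↦ ?_, fun φ hφ c ↦ ?_⟩
  · exact Summable.of_nonneg_of_le (fun n ↦ norm_nonneg _)
      (fun n ↦ norm_mul_exp_le b n (Complex.ofReal_im x).ge) hb
  · simp only [hq]
    refine tendsto_sum_coprime_div_totient (F := fun x ↦ G (qSeries b x))
      (hG.comp (continuous_qSeries_ofReal hb)) fun x ↦ ?_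
    simp only [Complex.ofReal_add, Complex.ofReal_one, qSeries_add_one]
  · simp only [hq]
    by_contra h0
    have hconst := linearMap_qSeries_const_of_volume_ne_zero hkn g hb hexp' φ (c := c)
      fun h ↦ h0 (measure_mono_null (fun x hx ↦ hx.2) h)
    have ha (m : ℕ) : a m = 0 := by
      rcases eq_or_ne m 0 with rfl | hm
      · exact ha0
      · rw [← hab, eq_zero_of_linearMap_qSeries_const hb hφ hconst hm, mul_zero]
    apply hg
    ext z
    simp [hexp, ha]
end
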